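/- arXiv:hep-th/0112006 — 4 statements merged into one kernel-verified Lean document; each statement's English description precedes it below -/
import Mathlib

section
/- Let Γ be a finitely generated free ℤ-module equipped with a symmetric bilinear form ⟨·,·⟩ that is even (⟨x,x⟩ ∈ 2ℤ for all x ∈ Γ) and unimodular (the map x ↦ ⟨x,·⟩ is an isomorphism from Γ onto Hom(Γ,ℤ)). Let Λ ⊆ Γ be a primitive sublattice (i.e. Γ/Λ is torsion-free) on which the restricted bilinear form is nondegenerate, and let V := {x ∈ Γ : ⟨x,λ⟩ = 0 for all λ ∈ Λ}. Identify the dual lattices Λ* := {x ∈ Λ⊗ℚ : ⟨x,λ⟩ ∈ ℤ for all λ ∈ Λ} and V* := {x ∈ V⊗ℚ : ⟨x,w⟩ ∈ ℤ for all w ∈ V}, and let q_Λ : Λ*/Λ → ℚ/2ℤ and q_V : V*/V → ℚ/2ℤ be the discriminant quadratic forms, q(x mod Λ) := ⟨x,x⟩ mod 2ℤ. Then the orthogonal projections p_Λ : Γ → Λ⊗ℚ and p_V : Γ → V⊗ℚ satisfy p_Λ(Γ) ⊆ Λ* and p_V(Γ) ⊆ V*, and there exists a group isomorphism γ : Λ*/Λ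 → V*/V with q_Λ = −q_V ∘ γ such that the map x ↦ (p_Λ(x), p_V(x)) is an isomorphism from Γ onto the subgroup {(λ,v) ∈ Λ* ⊕ V* : γ(λ mod Λ) = v mod V}. -/
open TensorProduct

section Lattice

variable {Γ : Type*} [AddCommGroup Γ]

theorem one_tmul_injective [Module.Free ℤ Γ] :
    Function.Injective fun x : Γ => (1 : ℚ) ⊗ₜ[ℤ] x := by
  have := Module.Flat.rTensor_preserves_injective_linearMap (M := Γ)
    (Algebra.linearMap ℤ ℚ) (Int.cast_injective)
  intro x y h
  have h' := @this ((1 : ℤ) ⊗ₜ x) ((1 : ℤ) ⊗ₜ y) (by simpa using h)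
  simpa using congrArg (TensorProduct.lid ℤ Γ) h'

theorem one_tmul_zsmul (n : ℤ) (x : Γ) :
    (1 : ℚ) ⊗ₜ[ℤ] (n • x) = (n : ℚ) • ((1 : ℚ) ⊗ₜ[ℤ] x) := by
  rw [TensorProduct.tmul_smul, TensorProduct.smul_tmul', TensorProduct.smul_tmul']
  simp

/-- Clearing denominators in the rational span of a sublattice. -/
theorem exists_smul_eq_one_tmul (P : Submodule ℤ Γ) {z : ℚ ⊗[ℤ] Γ}
    (hz : z ∈ Submodule.span ℚ ((fun x : Γ => (1 : ℚ) ⊗ₜ[ℤ] x) '' (P : Set Γ))) :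
    ∃ n : ℤ, n ≠ 0 ∧ ∃ x ∈ P, (n : ℚ) • z = (1 : ℚ) ⊗ₜ[ℤ] x := by
  induction hz using Submodule.span_induction with
  | mem z hz =>
    obtain ⟨x, hx, rfl⟩ := hz
    exact ⟨1, one_ne_zero, x, hx, by simp⟩
  | zero => exact ⟨1, one_ne_zero, 0, P.zero_mem, by simp⟩
  | add u v _ _ hu hv =>
    obtain ⟨n, hn, x, hx, hnx⟩ := hu
    obtain ⟨m, hm, y, hy, hmy⟩ := hv
    refine ⟨n * m, mul_ne_zero hn hm, m • x + n • y,
      P.add_mem (P.smul_mem _ hx) (P.smul_mem _ hy), ?_⟩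
    rw [TensorProduct.tmul_add, one_tmul_zsmul, one_tmul_zsmul, ← hnx, ← hmy, smul_smul, smul_smul, smul_add]
    push_cast
    rw [mul_comm (m : ℚ)]
  | smul a u _ hu =>
    obtain ⟨n, hn, x, hx, hnx⟩ := hu
    refine ⟨a.den * n, mul_ne_zero (by simp) hn, a.num • x, P.smul_mem _ hx, ?_⟩
    rw [one_tmul_zsmul, ← hnx, smul_smul, smul_smul]
    congr 1
    push_cast
    rw [mul_right_comm, mul_comm (a.den : ℚ) a, Rat.mul_den_eq_num]

/-- Functionals on a primitive sublattice of a unimodular lattice are represented by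
elements of the ambient lattice. -/
theorem exists_forall_eq_of_primitive [Module.Finite ℤ Γ] (B : Γ →ₗ[ℤ] Γ →ₗ[ℤ] ℤ)
    (hB : Function.Surjective fun x : Γ => B x) (P : Submodule ℤ Γ)
    (hP : ∀ (x : Γ) (n : ℤ), n ≠ 0 → n • x ∈ P → x ∈ P) (f : P →ₗ[ℤ] ℤ) :
    ∃ x, ∀ l : P, B x l = f l := by
  have : Module.IsTorsionFree ℤ (Γ ⧸ P) := by
    refine Module.IsTorsionFree.of_smul_eq_zero fun n x h => ?_
    obtain ⟨x, rfl⟩ := P.mkQ_surjective x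
    rw [or_iff_not_imp_left]
    intro hn
    rw [← map_smul] at h
    simp only [Submodule.mkQ_apply, Submodule.Quotient.mk_eq_zero] at h ⊢
    exact hP x n hn h
  have : Module.Free ℤ (Γ ⧸ P) := inferInstance
  obtain ⟨s, hs⟩ := Module.projective_lifting_property P.mkQ LinearMap.id P.mkQ_surjective
  have hr : ∀ x, x - s (P.mkQ x) ∈ P := fun x => by
    have := LinearMap.congr_fun hs (P.mkQ x)
    rw [← Submodule.Quotient.mk_eq_zero, ← Submodule.mkQ_apply, map_sub, sub_eq_zero]
    exact this.symm
  let r : Γ →ₗ[ℤ] P := (LinearMap.id - s ∘ₗ P.mkQ).codRestrict P hr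
  obtain ⟨x, hx⟩ := hB (f ∘ₗ r)
  refine ⟨x, fun l => ?_⟩
  have hl : r l = l := by
    ext
    simp [r, (Submodule.Quotient.mk_eq_zero P).2 l.2]
  have := LinearMap.congr_fun hx (l : Γ)
  simpa [hl] using this

/-- If `Bq z` takes integral values on a primitive sublattice `P`, then it agrees there with
the pairing against a lattice element. -/
theorem exists_represents_of_integral [Module.Finite ℤ Γ] (B : Γ →ₗ[ℤ] Γ →ₗ[ℤ] ℤ)
    (hB : Function.Surjective fun x : Γ => B x) (P : Submodule ℤ Γ)
    (hP : ∀ (x : Γ) (n : ℤ), n ≠ 0 → n • x ∈ P → x ∈ P)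
    (φ : (ℚ ⊗[ℤ] Γ) →ₗ[ℚ] ℚ)
    (hφ : ∀ l ∈ P, ∃ m : ℤ, φ ((1 : ℚ) ⊗ₜ[ℤ] l) = (m : ℚ)) :
    ∃ x, ∀ l ∈ P, (B x l : ℚ) = φ ((1 : ℚ) ⊗ₜ[ℤ] l) := by
  choose f hf using fun l : P => hφ l l.2
  let F : P →ₗ[ℤ] ℤ :=
    { toFun := f
      map_add' := fun a b => by
        apply Int.cast_injective (α := ℚ)
        push_cast
        rw [← hf, ← hf, ← hf, ← map_add, Submodule.coe_add, TensorProduct.tmul_add]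
      map_smul' := fun n a => by
        apply Int.cast_injective (α := ℚ)
        simp only [RingHom.id_apply, smul_eq_mul]
        push_cast
        rw [← hf, ← hf, Submodule.coe_smul, one_tmul_zsmul, map_smul, smul_eq_mul] }
  obtain ⟨x, hx⟩ := exists_forall_eq_of_primitive B hB P hP F
  exact ⟨x, fun l hl => by rw [hx ⟨l, hl⟩, hf ⟨l, hl⟩]; rfl⟩

/-- A linear functional vanishing on `P` vanishes on its rational span. -/
theorem eq_zero_of_mem_span (P : Submodule ℤ Γ) (φ : (ℚ ⊗[ℤ] Γ) →ₗ[ℚ] ℚ)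
    (hφ : ∀ l ∈ P, φ ((1 : ℚ) ⊗ₜ[ℤ] l) = 0) {z : ℚ ⊗[ℤ] Γ}
    (hz : z ∈ Submodule.span ℚ ((fun x : Γ => (1 : ℚ) ⊗ₜ[ℤ] x) '' (P : Set Γ))) :
    φ z = 0 := by
  suffices h : Submodule.span ℚ ((fun x : Γ => (1 : ℚ) ⊗ₜ[ℤ] x) '' (P : Set Γ)) ≤
      LinearMap.ker φ from h hz
  rw [Submodule.span_le]
  rintro _ ⟨l, hl, rfl⟩
  exact hφ l hl

/-- The rational span of a nondegenerate sublattice is nondegenerate. -/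
theorem eq_zero_of_mem_span_of_nondegenerate (B : Γ →ₗ[ℤ] Γ →ₗ[ℤ] ℤ)
    (Bq : (ℚ ⊗[ℤ] Γ) →ₗ[ℚ] (ℚ ⊗[ℤ] Γ) →ₗ[ℚ] ℚ)
    (hBq : ∀ x y : Γ, Bq ((1 : ℚ) ⊗ₜ[ℤ] x) ((1 : ℚ) ⊗ₜ[ℤ] y) = (B x y : ℚ))
    (P : Submodule ℤ Γ) (hP : ∀ x ∈ P, (∀ y ∈ P, B x y = 0) → x = 0) {z : ℚ ⊗[ℤ] Γ}
    (hz : z ∈ Submodule.span ℚ ((fun x : Γ => (1 : ℚ) ⊗ₜ[ℤ] x) '' (P : Set Γ)))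
    (h : ∀ l ∈ P, Bq z ((1 : ℚ) ⊗ₜ[ℤ] l) = 0) : z = 0 := by
  obtain ⟨n, hn, x, hx, hnx⟩ := exists_smul_eq_one_tmul P hz
  have hx0 : x = 0 := hP x hx fun y hy => by
    have : (B x y : ℚ) = 0 := by
      rw [← hBq, ← hnx, map_smul, LinearMap.smul_apply, h y hy, smul_zero]
    exact_mod_cast this
  rw [hx0, TensorProduct.tmul_zero] at hnx
  exact (smul_eq_zero.1 hnx).resolve_left (by exact_mod_cast hn)

/-- Elements of the lattice lying in the rational span of a primitive sublattice belong to it. -/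
theorem mem_of_one_tmul_mem_span [Module.Free ℤ Γ] (P : Submodule ℤ Γ)
    (hP : ∀ (x : Γ) (n : ℤ), n ≠ 0 → n • x ∈ P → x ∈ P) {x : Γ}
    (hx : (1 : ℚ) ⊗ₜ[ℤ] x ∈
      Submodule.span ℚ ((fun x : Γ => (1 : ℚ) ⊗ₜ[ℤ] x) '' (P : Set Γ))) : x ∈ P := by
  obtain ⟨n, hn, y, hy, hny⟩ := exists_smul_eq_one_tmul P hx
  refine hP x n hn ?_
  have : n • x = y := by
    apply one_tmul_injective
    change (1 : ℚ) ⊗ₜ[ℤ] (n • x) = (1 : ℚ) ⊗ₜ[ℤ] y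
    rw [← hny, one_tmul_zsmul]
  rwa [this]

end Lattice

/-- Nikulin's gluing theorem: an even unimodular lattice `Γ` is described, in terms of a
primitive nondegenerate sublattice `Λ` and its orthogonal complement `V`, by an
isomorphism `γ : Λ*/Λ ≃ V*/V` of discriminant groups with `q_Λ = -q_V ∘ γ`, via
`Γ ≅ {(λ,v) ∈ Λ* ⊕ V* : γ(λ̄) = v̄}` (the isomorphism being given by the orthogonal
projections onto `Λ ⊗ ℚ` and `V ⊗ ℚ`).  Here everything is carried out inside
`ℚ ⊗[ℤ] Γ`, with `ι x = 1 ⊗ x` the canonical map and `Bq` the extension of the form. -/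
theorem stmt0 (Γ : Type*) [AddCommGroup Γ] [Module ℤ Γ]
    [Module.Free ℤ Γ] [Module.Finite ℤ Γ]
    (B : Γ →ₗ[ℤ] Γ →ₗ[ℤ] ℤ)
    (hsymm : ∀ x y, B x y = B y x)
    (heven : ∀ x, ∃ n : ℤ, B x x = 2 * n)
    (hunimod : Function.Bijective fun x : Γ => B x)
    (Λ : Submodule ℤ Γ)
    -- `Λ` is primitive: `Γ/Λ` is torsion-free
    (hprim : ∀ (x : Γ) (n : ℤ), n ≠ 0 → n • x ∈ Λ → x ∈ Λ)
    -- the restricted form is nondegenerate on `Λ`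
    (hnd : ∀ x ∈ Λ, (∀ y ∈ Λ, B x y = 0) → x = 0)
    -- `V` is the orthogonal complement of `Λ` in `Γ`
    (V : Submodule ℤ Γ)
    (hV : (V : Set Γ) = {x | ∀ l ∈ Λ, B x l = 0})
    -- the extension `Bq` of the bilinear form to `Γ ⊗ ℚ`
    (Bq : (ℚ ⊗[ℤ] Γ) →ₗ[ℚ] (ℚ ⊗[ℤ] Γ) →ₗ[ℚ] ℚ)
    (hBq : ∀ x y : Γ, Bq ((1 : ℚ) ⊗ₜ[ℤ] x) ((1 : ℚ) ⊗ₜ[ℤ] y) = (B x y : ℚ))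
    -- the orthogonal projections `p_Λ` and `p_V` onto `Λ ⊗ ℚ` and `V ⊗ ℚ`
    (pL pV : (ℚ ⊗[ℤ] Γ) →ₗ[ℚ] (ℚ ⊗[ℤ] Γ))
    (hproj : ∀ z : ℚ ⊗[ℤ] Γ,
      pL z ∈ Submodule.span ℚ ((fun x : Γ => (1 : ℚ) ⊗ₜ[ℤ] x) '' (Λ : Set Γ)) ∧
      pV z ∈ Submodule.span ℚ ((fun x : Γ => (1 : ℚ) ⊗ₜ[ℤ] x) '' (V : Set Γ)) ∧
      pL z + pV z = z)
    -- the dual lattices `Λ* ⊆ Λ ⊗ ℚ` and `V* ⊆ V ⊗ ℚ`, and the images of `Λ` and `V`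
    (LStar VStar L0 V0 : AddSubgroup (ℚ ⊗[ℤ] Γ))
    (hLStar : (LStar : Set (ℚ ⊗[ℤ] Γ)) =
      {z | z ∈ Submodule.span ℚ ((fun x : Γ => (1 : ℚ) ⊗ₜ[ℤ] x) '' (Λ : Set Γ)) ∧
        ∀ l ∈ Λ, ∃ m : ℤ, Bq z ((1 : ℚ) ⊗ₜ[ℤ] l) = (m : ℚ)})
    (hVStar : (VStar : Set (ℚ ⊗[ℤ] Γ)) =
      {z | z ∈ Submodule.span ℚ ((fun x : Γ => (1 : ℚ) ⊗ₜ[ℤ] x) '' (V : Set Γ)) ∧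
        ∀ w ∈ V, ∃ m : ℤ, Bq z ((1 : ℚ) ⊗ₜ[ℤ] w) = (m : ℚ)})
    (hL0 : (L0 : Set (ℚ ⊗[ℤ] Γ)) = (fun x : Γ => (1 : ℚ) ⊗ₜ[ℤ] x) '' (Λ : Set Γ))
    (hV0 : (V0 : Set (ℚ ⊗[ℤ] Γ)) = (fun x : Γ => (1 : ℚ) ⊗ₜ[ℤ] x) '' (V : Set Γ)) :
    -- the projections map `Γ` into the dual lattices …
    (∀ x : Γ, pL ((1 : ℚ) ⊗ₜ[ℤ] x) ∈ LStar) ∧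
    (∀ x : Γ, pV ((1 : ℚ) ⊗ₜ[ℤ] x) ∈ VStar) ∧
    -- … and there is an isomorphism `γ : Λ*/Λ ≃ V*/V` with `q_Λ = -q_V ∘ γ`
    ∃ γ : (↥LStar ⧸ L0.addSubgroupOf LStar) ≃+ (↥VStar ⧸ V0.addSubgroupOf VStar),
      (∀ (a : LStar) (c : VStar),
        γ (QuotientAddGroup.mk a) = QuotientAddGroup.mk c →
        ∃ m : ℤ, Bq (a : ℚ ⊗[ℤ] Γ) (a : ℚ ⊗[ℤ] Γ) +
          Bq (c : ℚ ⊗[ℤ] Γ) (c : ℚ ⊗[ℤ] Γ) = 2 * (m : ℚ)) ∧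
      -- such that `x ↦ (p_Λ x, p_V x)` identifies `Γ` with `{(λ,v) : γ(λ̄) = v̄}`
      Function.Injective
        (fun x : Γ => (pL ((1 : ℚ) ⊗ₜ[ℤ] x), pV ((1 : ℚ) ⊗ₜ[ℤ] x))) ∧
      Set.range (fun x : Γ => (pL ((1 : ℚ) ⊗ₜ[ℤ] x), pV ((1 : ℚ) ⊗ₜ[ℤ] x))) =
        {z : (ℚ ⊗[ℤ] Γ) × (ℚ ⊗[ℤ] Γ) |
          ∃ (ha : z.1 ∈ LStar) (hb : z.2 ∈ VStar),
            γ (QuotientAddGroup.mk ⟨z.1, ha⟩) = QuotientAddGroup.mk ⟨z.2, hb⟩} := by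
  obtain rfl : ‹Module ℤ Γ› = AddCommGroup.toIntModule Γ := Subsingleton.elim _ _
  have mem_V : ∀ {x}, x ∈ V ↔ ∀ l ∈ Λ, B x l = 0 := fun {x} => Set.ext_iff.1 hV x
  have mem_LStar := fun z => Set.ext_iff.1 hLStar z
  have mem_VStar := fun z => Set.ext_iff.1 hVStar z
  have mem_L0 := fun z => Set.ext_iff.1 hL0 z
  have mem_V0 := fun z => Set.ext_iff.1 hV0 z
  simp only [SetLike.mem_coe, Set.mem_ofPred_eq,
    Set.mem_image] at mem_LStar mem_VStar mem_L0 mem_V0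
  have hVprim : ∀ (x : Γ) (n : ℤ), n ≠ 0 → n • x ∈ V → x ∈ V := by
    intro x n hn h
    rw [mem_V] at h ⊢
    intro l hl
    have := h l hl
    rw [map_smul, LinearMap.smul_apply, smul_eq_mul] at this
    exact (mul_eq_zero.1 this).resolve_left hn
  set LQ := Submodule.span ℚ ((fun x : Γ => (1 : ℚ) ⊗ₜ[ℤ] x) '' (Λ : Set Γ)) with hLQ
  set VQ := Submodule.span ℚ ((fun x : Γ => (1 : ℚ) ⊗ₜ[ℤ] x) '' (V : Set Γ)) with hVQ
  have hιL : ∀ l ∈ Λ, (1 : ℚ) ⊗ₜ[ℤ] l ∈ LQ := fun l hl => Submodule.subset_span ⟨l, hl, rfl⟩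
  have hιV : ∀ v ∈ V, (1 : ℚ) ⊗ₜ[ℤ] v ∈ VQ := fun l hl => Submodule.subset_span ⟨l, hl, rfl⟩
  have horthV : ∀ v ∈ VQ, ∀ l ∈ Λ, Bq v ((1 : ℚ) ⊗ₜ[ℤ] l) = 0 := fun v hv l hl =>
    eq_zero_of_mem_span V (Bq.flip ((1 : ℚ) ⊗ₜ[ℤ] l))
      (fun w hw => by simp [hBq, mem_V.1 hw l hl]) hv
  have horthL : ∀ u ∈ LQ, ∀ v ∈ V, Bq u ((1 : ℚ) ⊗ₜ[ℤ] v) = 0 := fun u hu v hv =>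
    eq_zero_of_mem_span Λ (Bq.flip ((1 : ℚ) ⊗ₜ[ℤ] v))
      (fun w hw => by simp [hBq, hsymm w v, mem_V.1 hv w hw]) hu
  have hVL : ∀ v ∈ VQ, ∀ u ∈ LQ, Bq v u = 0 := fun v hv u hu =>
    eq_zero_of_mem_span Λ (Bq v) (horthV v hv) hu
  have hLV : ∀ u ∈ LQ, ∀ v ∈ VQ, Bq u v = 0 := fun u hu v hv =>
    eq_zero_of_mem_span V (Bq u) (horthL u hu) hv
  have hndL : ∀ u ∈ LQ, (∀ l ∈ Λ, Bq u ((1 : ℚ) ⊗ₜ[ℤ] l) = 0) → u = 0 := fun u hu h =>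
    eq_zero_of_mem_span_of_nondegenerate B Bq hBq Λ hnd hu h
  have hndV : ∀ v ∈ VQ, (∀ w ∈ V, Bq v ((1 : ℚ) ⊗ₜ[ℤ] w) = 0) → v = 0 := by
    intro v hv h
    refine eq_zero_of_mem_span_of_nondegenerate B Bq hBq ⊤ (fun x _ hx => ?_)
      (Submodule.span_mono (Set.image_mono (Set.subset_univ _)) hv) (fun y _ => ?_)
    · apply hunimod.injective
      ext y
      simpa using hx y trivial
    · obtain ⟨h1, h2, h3⟩ := hproj ((1 : ℚ) ⊗ₜ[ℤ] y)
      rw [← h3, map_add, hVL v hv _ h1, eq_zero_of_mem_span V (Bq v) h h2, add_zero]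
  have hdisj : ∀ u ∈ LQ, u ∈ VQ → u = 0 := fun u hu hu' => hndL u hu (horthV u hu')
  have huniq : ∀ z, ∀ u ∈ LQ, ∀ v ∈ VQ, u + v = z → pL z = u ∧ pV z = v := by
    rintro _ u hu v hv rfl
    obtain ⟨h1, h2, h3⟩ := hproj (u + v)
    have h4 : pL (u + v) - u = v - pV (u + v) := by
      rw [sub_eq_sub_iff_add_eq_add, h3, add_comm]
    have h5 := hdisj _ (LQ.sub_mem h1 hu) (h4 ▸ VQ.sub_mem hv h2)
    exact ⟨sub_eq_zero.1 h5, (sub_eq_zero.1 (h4 ▸ h5)).symm⟩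
  have hBL : ∀ x : Γ, ∀ l ∈ Λ, Bq (pL ((1 : ℚ) ⊗ₜ[ℤ] x)) ((1 : ℚ) ⊗ₜ[ℤ] l) = B x l := by
    intro x l hl
    obtain ⟨h1, h2, h3⟩ := hproj ((1 : ℚ) ⊗ₜ[ℤ] x)
    rw [← hBq, ← congrArg Bq h3, map_add, LinearMap.add_apply, horthV _ h2 l hl, add_zero]
  have hBV : ∀ x : Γ, ∀ w ∈ V, Bq (pV ((1 : ℚ) ⊗ₜ[ℤ] x)) ((1 : ℚ) ⊗ₜ[ℤ] w) = B x w := by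
    intro x l hl
    obtain ⟨h1, h2, h3⟩ := hproj ((1 : ℚ) ⊗ₜ[ℤ] x)
    rw [← hBq, ← congrArg Bq h3, map_add, LinearMap.add_apply, horthL _ h1 l hl, zero_add]
  have hpL : ∀ x : Γ, pL ((1 : ℚ) ⊗ₜ[ℤ] x) ∈ LStar := fun x =>
    (mem_LStar _).2 ⟨(hproj _).1, fun l hl => ⟨B x l, hBL x l hl⟩⟩
  have hpV : ∀ x : Γ, pV ((1 : ℚ) ⊗ₜ[ℤ] x) ∈ VStar := fun x =>
    (mem_VStar _).2 ⟨(hproj _).2.1, fun l hl => ⟨B x l, hBV x l hl⟩⟩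
  have hsurjL : ∀ a ∈ LStar, ∃ x : Γ, pL ((1 : ℚ) ⊗ₜ[ℤ] x) = a := by
    intro a ha
    obtain ⟨ha1, ha2⟩ := (mem_LStar a).1 ha
    obtain ⟨x, hx⟩ := exists_represents_of_integral B hunimod.surjective Λ hprim (Bq a) ha2
    refine ⟨x, sub_eq_zero.1 (hndL _ (LQ.sub_mem (hproj _).1 ha1) fun l hl => ?_)⟩
    rw [map_sub, LinearMap.sub_apply, hBL x l hl, hx l hl, sub_self]
  have hsurjV : ∀ a ∈ VStar, ∃ x : Γ, pV ((1 : ℚ) ⊗ₜ[ℤ] x) = a := by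
    intro a ha
    obtain ⟨ha1, ha2⟩ := (mem_VStar a).1 ha
    obtain ⟨x, hx⟩ := exists_represents_of_integral B hunimod.surjective V hVprim (Bq a) ha2
    refine ⟨x, sub_eq_zero.1 (hndV _ (VQ.sub_mem (hproj _).2.1 ha1) fun l hl => ?_)⟩
    rw [map_sub, LinearMap.sub_apply, hBV x l hl, hx l hl, sub_self]
  let f : Γ →+ ↥LStar ⧸ L0.addSubgroupOf LStar :=
    (QuotientAddGroup.mk' _).comp (AddMonoidHom.mk' (fun x => ⟨_, hpL x⟩) fun x y => by
      ext; simp [TensorProduct.tmul_add])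
  let g : Γ →+ ↥VStar ⧸ V0.addSubgroupOf VStar :=
    (QuotientAddGroup.mk' _).comp (AddMonoidHom.mk' (fun x => ⟨_, hpV x⟩) fun x y => by
      ext; simp [TensorProduct.tmul_add])
  have hf : Function.Surjective f := by
    intro q
    obtain ⟨⟨a, ha⟩, rfl⟩ := QuotientAddGroup.mk_surjective q
    obtain ⟨x, rfl⟩ := hsurjL a ha
    exact ⟨x, rfl⟩
  have hg : Function.Surjective g := by
    intro q
    obtain ⟨⟨a, ha⟩, rfl⟩ := QuotientAddGroup.mk_surjective q
    obtain ⟨x, rfl⟩ := hsurjV a ha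
    exact ⟨x, rfl⟩
  have hker : f.ker = g.ker := by
    ext x
    have hfx : x ∈ f.ker ↔ pL ((1 : ℚ) ⊗ₜ[ℤ] x) ∈ L0 := QuotientAddGroup.eq_zero_iff _
    have hgx : x ∈ g.ker ↔ pV ((1 : ℚ) ⊗ₜ[ℤ] x) ∈ V0 := QuotientAddGroup.eq_zero_iff _
    rw [hfx, hgx, mem_L0, mem_V0]
    obtain ⟨h1, h2, h3⟩ := hproj ((1 : ℚ) ⊗ₜ[ℤ] x)
    constructor
    · rintro ⟨l, hl, h⟩
      have h4 : (1 : ℚ) ⊗ₜ[ℤ] (x - l) = pV ((1 : ℚ) ⊗ₜ[ℤ] x) := by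
        rw [TensorProduct.tmul_sub, h, sub_eq_iff_eq_add', h3]
      exact ⟨x - l, mem_of_one_tmul_mem_span V hVprim (h4 ▸ h2), h4⟩
    · rintro ⟨l, hl, h⟩
      have h4 : (1 : ℚ) ⊗ₜ[ℤ] (x - l) = pL ((1 : ℚ) ⊗ₜ[ℤ] x) := by
        rw [TensorProduct.tmul_sub, h, sub_eq_iff_eq_add, h3]
      exact ⟨x - l, mem_of_one_tmul_mem_span Λ hprim (h4 ▸ h1), h4⟩
  let γ : (↥LStar ⧸ L0.addSubgroupOf LStar) ≃+ (↥VStar ⧸ V0.addSubgroupOf VStar) :=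
    (QuotientAddGroup.quotientKerEquivOfSurjective f hf).symm.trans
      ((QuotientAddGroup.quotientAddEquivOfEq hker).trans
        (QuotientAddGroup.quotientKerEquivOfSurjective g hg))
  have hγ : ∀ x, γ (f x) = g x := by
    intro x
    have : (QuotientAddGroup.quotientKerEquivOfSurjective f hf).symm (f x) =
        (QuotientAddGroup.mk x : Γ ⧸ f.ker) := by
      rw [AddEquiv.symm_apply_eq]
      rfl
    simp only [γ, AddEquiv.trans_apply, this]
    rfl
  have hglue : ∀ (a : LStar) (c : VStar), γ (QuotientAddGroup.mk a) = QuotientAddGroup.mk c →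
      ∃ x : Γ, pL ((1 : ℚ) ⊗ₜ[ℤ] x) = a ∧ pV ((1 : ℚ) ⊗ₜ[ℤ] x) = c := by
    rintro ⟨a, ha⟩ ⟨c, hc⟩ h
    obtain ⟨x, rfl⟩ := hsurjL a ha
    have h' : (QuotientAddGroup.mk ⟨_, hpV x⟩ : ↥VStar ⧸ V0.addSubgroupOf VStar) =
      QuotientAddGroup.mk ⟨c, hc⟩ := (hγ x).symm.trans h
    rw [QuotientAddGroup.eq, AddSubgroup.mem_addSubgroupOf] at h'
    obtain ⟨v, hv, hvc⟩ := (mem_V0 _).1 h'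
    obtain ⟨h1, h2⟩ := huniq _ 0 LQ.zero_mem _ (hιV v hv) (zero_add _)
    refine ⟨x + v, ?_, ?_⟩
    · rw [TensorProduct.tmul_add, map_add, h1, add_zero]
    · rw [TensorProduct.tmul_add, map_add, h2, hvc]
      simp
  refine ⟨hpL, hpV, γ, fun a c hac => ?_, fun x y hxy => ?_, ?_⟩
  · obtain ⟨x, hxa, hxc⟩ := hglue a c hac
    obtain ⟨h1, h2, h3⟩ := hproj ((1 : ℚ) ⊗ₜ[ℤ] x)
    obtain ⟨m, hm⟩ := heven x
    refine ⟨m, ?_⟩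
    have h4 : (B x x : ℚ) = 2 * m := by exact_mod_cast hm
    rw [← h4, ← hBq, ← hxa, ← hxc]
    conv_rhs => rw [← h3]
    simp only [map_add, LinearMap.add_apply]
    rw [hLV _ h1 _ h2, hVL _ h2 _ h1]
    ring
  · have h := congrArg (fun p => p.1 + p.2) hxy
    simp only [(hproj _).2.2] at h
    exact one_tmul_injective h
  · ext ⟨a, c⟩
    constructor
    · rintro ⟨x, hx⟩
      obtain ⟨rfl, rfl⟩ := Prod.mk.inj hx
      exact ⟨hpL x, hpV x, hγ x⟩
    · rintro ⟨ha, hc, h⟩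
      obtain ⟨x, h1, h2⟩ := hglue _ _ h
      exact ⟨x, Prod.ext h1 h2⟩
end

section
/- Let δ be a natural number and let ℝ^{4,4+δ} denote ℝ^{8+δ} equipped with the symmetric bilinear form ⟨x,y⟩ = Σ_{i=1}^{4} x_i y_i − Σ_{i=5}^{8+δ} x_i y_i. Let υ, υ⁰ ∈ ℝ^{4,4+δ} satisfy ⟨υ,υ⟩ = 0, ⟨υ⁰,υ⁰⟩ = 0 and ⟨υ,υ⁰⟩ = 1, and set W′ := {w : ⟨w,υ⟩ = 0 and ⟨w,υ⁰⟩ = 0}. For a 3-dimensional subspace Σ ⊆ W′ on which the form is positive definite, a real number V > 0 and a vector B ∈ W′, define ξ(σ) := σ − ⟨B,σ⟩·υ for σ ∈ Σ, define ξ₄ := υ⁰ + B + (V − ½⟨B,B⟩)·υ, and let Φ(Σ,V,B) be the 4-dimensional subspace spanned by {ξ(σ) : σ ∈ Σ} together with ξ₄. Then Φ is a bijection from the set of all such triples (Σ,V,B) onto the set of 4-dimensional linear subspaces x of ℝ^{4,4+δ} on which the bilinear form is positive definite. -/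
/-- The symmetric bilinear form of signature `(p,q)` on `ℝ^{p+q}`:
`⟨x,y⟩ = ∑_{i<p} x i * y i - ∑_{p ≤ i} x i * y i`. -/
noncomputable def pqForm (p q : ℕ) (x y : Fin (p + q) → ℝ) : ℝ :=
  ∑ i : Fin (p + q), (if (i : ℕ) < p then (1 : ℝ) else -1) * x i * y i

open Module

section HyperbolicSplitting

variable {E : Type*} [AddCommGroup E] [Module ℝ E]

/-- The map `(σ, r) ↦ σ - ⟨B, σ⟩ υ + r u` on `S × ℝ`. -/
noncomputable def shearMap (b : LinearMap.BilinForm ℝ E) (υ B u : E) (S : Submodule ℝ E) :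
    S × ℝ →ₗ[ℝ] E :=
  ((LinearMap.id - (b B).smulRight υ).comp S.subtype).coprod
    ((LinearMap.id : ℝ →ₗ[ℝ] ℝ).smulRight u)

theorem shearMap_apply (b : LinearMap.BilinForm ℝ E) (υ B u : E) (S : Submodule ℝ E)
    (y : S × ℝ) : shearMap b υ B u S y = y.1 - b B y.1 • υ + y.2 • u := by
  simp [shearMap]

/-- The span of the sheared subspace and the vector `u`. -/
def shearSpan (b : LinearMap.BilinForm ℝ E) (υ B u : E) (S : Submodule ℝ E) : Submodule ℝ E :=
  Submodule.span ℝ ((fun σ => σ - b B σ • υ) '' (S : Set E) ∪ {u})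

theorem shearSpan_eq_range (b : LinearMap.BilinForm ℝ E) (υ B u : E) (S : Submodule ℝ E) :
    shearSpan b υ B u S = LinearMap.range (shearMap b υ B u S) := by
  apply le_antisymm
  · rw [shearSpan, Submodule.span_le]
    rintro _ (⟨σ, hσ, rfl⟩ | rfl)
    · exact ⟨(⟨σ, hσ⟩, 0), by simp [shearMap_apply]⟩
    · exact ⟨(0, 1), by simp [shearMap_apply]⟩
  · rintro _ ⟨⟨σ, r⟩, rfl⟩
    rw [shearMap_apply]
    exact add_mem (Submodule.subset_span (.inl ⟨σ, σ.2, rfl⟩))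
      (Submodule.smul_mem _ _ (Submodule.subset_span (.inr rfl)))

theorem mem_shearSpan {b : LinearMap.BilinForm ℝ E} {υ B u : E} {S : Submodule ℝ E} {y : E} :
    y ∈ shearSpan b υ B u S ↔ ∃ σ ∈ S, ∃ r : ℝ, σ - b B σ • υ + r • u = y := by
  rw [shearSpan_eq_range]
  simp [shearMap_apply]

variable {b : LinearMap.BilinForm ℝ E} {υ υ₀ : E}

theorem form_shearMap_self (hb : ∀ x y, b x y = b y x) (h : b υ υ = 0) (h₀ : b υ₀ υ₀ = 0)
    (h₁ : b υ υ₀ = 1) {B σ : E} {V : ℝ} (hB : b B υ = 0) (hB₀ : b B υ₀ = 0)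
    (hσ : b σ υ = 0) (hσ₀ : b σ υ₀ = 0) (r : ℝ) :
    b (σ - b B σ • υ + r • (υ₀ + B + (V - 1 / 2 * b B B) • υ))
      (σ - b B σ • υ + r • (υ₀ + B + (V - 1 / 2 * b B B) • υ)) = b σ σ + 2 * V * r ^ 2 := by
  simp only [map_add, map_sub, map_smul, LinearMap.add_apply, LinearMap.sub_apply,
    LinearMap.smul_apply, smul_eq_mul, h, h₀, h₁, hB, hB₀, hσ, hσ₀, hb υ₀ υ, hb υ B, hb υ₀ B,
    hb υ σ, hb υ₀ σ, hb σ B]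
  ring

theorem form_shearMap_null (hb : ∀ x y, b x y = b y x) (h : b υ υ = 0)
    (h₁ : b υ υ₀ = 1) {B σ : E} {c : ℝ} (hB : b B υ = 0) (hσ : b σ υ = 0) (r : ℝ) :
    b (σ - b B σ • υ + r • (υ₀ + B + c • υ)) υ = r := by
  simp [h, h₁, hB, hσ, hb υ₀ υ]

theorem shearSpan_finrank_and_posDef [FiniteDimensional ℝ E]
    (hb : ∀ x y, b x y = b y x) (h : b υ υ = 0)
    (h₀ : b υ₀ υ₀ = 0) (h₁ : b υ υ₀ = 1) {B : E} {V : ℝ} (hV : 0 < V) (hB : b B υ = 0)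
    (hB₀ : b B υ₀ = 0) {S : Submodule ℝ E} (hpos : ∀ v ∈ S, v ≠ 0 → 0 < b v v)
    (hS : ∀ v ∈ S, b v υ = 0 ∧ b v υ₀ = 0) :
    finrank ℝ (shearSpan b υ B (υ₀ + B + (V - 1 / 2 * b B B) • υ) S) = finrank ℝ S + 1 ∧
      ∀ v ∈ shearSpan b υ B (υ₀ + B + (V - 1 / 2 * b B B) • υ) S, v ≠ 0 → 0 < b v v := by
  have key : ∀ σ ∈ S, ∀ r : ℝ, (σ, r) ≠ 0 → 0 < b σ σ + 2 * V * r ^ 2 := by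
    intro σ hσ r hne
    by_cases h_σ : σ = 0
    · have hr : r ≠ 0 := by rintro rfl; exact hne (by simp [h_σ])
      simp only [h_σ, map_zero, zero_add]
      positivity
    · have := hpos σ hσ h_σ
      positivity
  have inj : Function.Injective (shearMap b υ B (υ₀ + B + (V - 1 / 2 * b B B) • υ) S) := by
    rw [injective_iff_map_eq_zero]
    rintro ⟨⟨σ, hσ⟩, r⟩ hy
    by_contra hne
    have hk := key σ hσ r fun e => hne <| by
      rw [Prod.mk_eq_zero] at e ⊢
      exact ⟨Subtype.ext e.1, e.2⟩
    rw [shearMap_apply] at hy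
    dsimp only at hy
    rw [← form_shearMap_self hb h h₀ h₁ hB hB₀ (hS σ hσ).1 (hS σ hσ).2, hy, map_zero] at hk
    exact hk.false
  constructor
  · rw [shearSpan_eq_range, LinearMap.finrank_range_of_inj inj, finrank_prod, finrank_self]
  · intro v hv hne
    obtain ⟨σ, hσ, r, rfl⟩ := mem_shearSpan.1 hv
    rw [form_shearMap_self hb h h₀ h₁ hB hB₀ (hS σ hσ).1 (hS σ hσ).2]
    refine key σ hσ r fun e => hne ?_
    simp [(Prod.mk_eq_zero.1 e).1, (Prod.mk_eq_zero.1 e).2]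

theorem vector_eq_of_shearSpan_le (hb : ∀ x y, b x y = b y x) (h : b υ υ = 0)
    (h₁ : b υ υ₀ = 1) {B B' : E} {c c' : ℝ}
    (hB : b B υ = 0) (hB' : b B' υ = 0) {S S' : Submodule ℝ E}
    (hpos : ∀ v ∈ S, v ≠ 0 → 0 < b v v) (hS : ∀ v ∈ S, b v υ = 0 ∧ b v υ₀ = 0)
    (hS' : ∀ v ∈ S', b v υ = 0 ∧ b v υ₀ = 0)
    (heq : shearSpan b υ B (υ₀ + B + c • υ) S = shearSpan b υ B' (υ₀ + B' + c' • υ) S') :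
    υ₀ + B + c • υ = υ₀ + B' + c' • υ := by
  have hu : υ₀ + B' + c' • υ ∈ shearSpan b υ B (υ₀ + B + c • υ) S :=
    heq ▸ Submodule.subset_span (.inr rfl)
  obtain ⟨σ, hσ, r, hr⟩ := mem_shearSpan.1 hu
  have hr1 : r = 1 := by
    rw [← form_shearMap_null hb h h₁ hB (hS σ hσ).1 (c := c) r, hr]
    simp [h, h₁, hB', hb υ₀ υ]
  subst hr1
  have hm : σ - b B σ • υ ∈ shearSpan b υ B' (υ₀ + B' + c' • υ) S' :=
    heq ▸ Submodule.subset_span (.inl ⟨σ, hσ, rfl⟩)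
  obtain ⟨σ', hσ', r', hr'⟩ := mem_shearSpan.1 hm
  have hr0 : r' = 0 := by
    rw [← form_shearMap_null hb h h₁ hB' (hS' σ' hσ').1 (c := c') r', hr']
    simp [h, (hS σ hσ).1]
  subst hr0
  rw [zero_smul, add_zero] at hr'
  have e1 : b (σ - b B σ • υ) (υ₀ + B' + c' • υ) = 0 := by
    rw [← hr']
    simp [h, h₁, hb υ B', hB', (hS' σ' hσ').1, (hS' σ' hσ').2, hb σ' B']
  have e2 : b σ σ = 0 := by
    rw [← hr] at e1
    simpa [h, h₁, hb υ B, hB, (hS σ hσ).1, (hS σ hσ).2, hb σ B, hb υ σ] using e1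
  have h_σ : σ = 0 := by
    by_contra hne
    exact (hpos σ hσ hne).ne' e2
  simpa [h_σ] using hr

theorem le_of_shearSpan_eq (hb : ∀ x y, b x y = b y x) (h : b υ υ = 0)
    (h₁ : b υ υ₀ = 1) {B : E} {c : ℝ} (hB : b B υ = 0) {S S' : Submodule ℝ E}
    (hS : ∀ v ∈ S, b v υ = 0 ∧ b v υ₀ = 0) (hS' : ∀ v ∈ S', b v υ = 0 ∧ b v υ₀ = 0)
    (heq : shearSpan b υ B (υ₀ + B + c • υ) S = shearSpan b υ B (υ₀ + B + c • υ) S') :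
    S ≤ S' := by
  intro σ hσ
  have hm : σ - b B σ • υ ∈ shearSpan b υ B (υ₀ + B + c • υ) S' :=
    heq ▸ Submodule.subset_span (.inl ⟨σ, hσ, rfl⟩)
  obtain ⟨σ', hσ', r', hr'⟩ := mem_shearSpan.1 hm
  have hr0 : r' = 0 := by
    rw [← form_shearMap_null hb h h₁ hB (hS' σ' hσ').1 (c := c) r', hr']
    simp [h, (hS σ hσ).1]
  subst hr0
  rw [zero_smul, add_zero] at hr'
  have e := congrArg (fun z => b z υ₀) hr'
  simp only [map_sub, map_smul, LinearMap.sub_apply, LinearMap.smul_apply, (hS σ hσ).2,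
    (hS' σ' hσ').2, h₁, smul_eq_mul, mul_one, zero_sub, neg_inj] at e
  rw [e] at hr'
  rwa [← sub_left_injective hr']

theorem exists_form_eq_dual [FiniteDimensional ℝ E] {x : Submodule ℝ E}
    (hx : ∀ v ∈ x, v ≠ 0 → 0 < b v v) (f : x →ₗ[ℝ] ℝ) :
    ∃ w : x, ∀ y : x, b w y = f y := by
  have inj : Function.Injective (b.restrict x) := by
    rw [injective_iff_map_eq_zero]
    intro v hv
    by_contra hne
    have := hx v v.2 (by simpa using hne)
    have e : b.restrict x v v = 0 := by rw [hv]; rfl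
    rw [LinearMap.BilinForm.restrict_apply] at e
    exact this.ne' e
  obtain ⟨w, hw⟩ := (LinearMap.injective_iff_surjective_of_finrank_eq_finrank
    (Subspace.dual_finrank_eq (K := ℝ) (V := x)).symm).1 inj f
  exact ⟨w, fun y => by rw [← hw]; rfl⟩

theorem exists_shearSpan_eq [FiniteDimensional ℝ E] (hb : ∀ x y, b x y = b y x) (h : b υ υ = 0)
    (h₀ : b υ₀ υ₀ = 0) (h₁ : b υ υ₀ = 1) {n : ℕ} {x : Submodule ℝ E}
    (hn : finrank ℝ x = n + 1) (hx : ∀ v ∈ x, v ≠ 0 → 0 < b v v)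
    (hne : ∃ v ∈ x, b v υ ≠ 0) :
    ∃ (S : Submodule ℝ E) (V : ℝ) (B : E), finrank ℝ S = n ∧ (∀ v ∈ S, v ≠ 0 → 0 < b v v) ∧
      (∀ v ∈ S, b v υ = 0 ∧ b v υ₀ = 0) ∧ 0 < V ∧ b B υ = 0 ∧ b B υ₀ = 0 ∧
      shearSpan b υ B (υ₀ + B + (V - 1 / 2 * b B B) • υ) S = x := by
  have hb' : b υ₀ υ = 1 := by rw [hb, h₁]
  let f : x →ₗ[ℝ] ℝ := (b υ).domRestrict x
  have hf : ∀ y : x, f y = b υ y := fun _ => rfl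
  obtain ⟨w, hw⟩ := exists_form_eq_dual hx f
  obtain ⟨v, hvx, hv⟩ := hne
  have hw0 : (w : E) ≠ 0 := by
    intro e
    have := hw ⟨v, hvx⟩
    rw [e, hf, hb υ] at this
    exact hv (by simpa using this.symm)
  have hww := hx w w.2 hw0
  obtain ⟨u, hu⟩ : ∃ u : E, u = (b w w)⁻¹ • (w : E) := ⟨_, rfl⟩
  have hux : u ∈ x := hu ▸ x.smul_mem _ w.2
  have hu1 : b u υ = 1 := by
    rw [hu, hb, map_smul, ← hf w, ← hw w, smul_eq_mul, inv_mul_cancel₀ hww.ne']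
  have hu_orth : ∀ y ∈ x, b υ y = 0 → b u y = 0 := by
    intro y hy hy0
    rw [hu, map_smul, LinearMap.smul_apply, hw ⟨y, hy⟩, hf, hy0, smul_zero]
  have hu0 : u ≠ 0 := by rintro rfl; simp at hu1
  obtain ⟨B, hB⟩ : ∃ B : E, B = u - υ₀ - b u υ₀ • υ := ⟨_, rfl⟩
  have hBυ : b B υ = 0 := by simp [hB, hu1, hb', h]
  have hBυ₀ : b B υ₀ = 0 := by simp [hB, h₀, h₁]
  have hBB : b B B = b u u - 2 * b u υ₀ := by
    simp only [hB, map_sub, map_smul, LinearMap.sub_apply, LinearMap.smul_apply, smul_eq_mul, h,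
      h₀, h₁, hb', hu1, hb υ u, hb υ₀ u]
    ring
  have hu_eq : υ₀ + B + (1 / 2 * b u u - 1 / 2 * b B B) • υ = u := by
    rw [hBB, show 1 / 2 * b u u - 1 / 2 * (b u u - 2 * b u υ₀) = b u υ₀ by ring, hB]
    abel
  let P : E →ₗ[ℝ] E := LinearMap.id - (b υ₀).smulRight υ
  have hP : ∀ k, P k = k - b υ₀ k • υ := fun k => by simp [P]
  let K : Submodule ℝ E := (LinearMap.ker f).map x.subtype
  have hK : ∀ k, k ∈ K ↔ k ∈ x ∧ b υ k = 0 := by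
    intro k
    simp [K, hf, and_comm]
  have hPP : ∀ k ∈ K, b (P k) (P k) = b k k := by
    intro k hk
    simp [hP, h, ((hK k).1 hk).2, hb k υ]
  have hPξ : ∀ k ∈ K, P k - b B (P k) • υ = k := by
    intro k hk
    have : b B (P k) = - b υ₀ k := by
      rw [hP, map_sub, map_smul, hBυ, hB]
      simp [((hK k).1 hk).2, hu_orth k ((hK k).1 hk).1 ((hK k).1 hk).2]
    rw [this, hP, neg_smul]
    abel
  have inj : Function.Injective (P.domRestrict K) := by
    rw [injective_iff_map_eq_zero]
    rintro ⟨k, hk⟩ hk0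
    rw [LinearMap.domRestrict_apply] at hk0
    have := hPξ k hk
    simp only [Submodule.mk_eq_zero]
    simpa [show P k = 0 from hk0] using this.symm
  have hf_ne : f ≠ 0 := by
    intro e
    apply hv
    rw [hb, ← hf ⟨v, hvx⟩, e]
    rfl
  refine ⟨K.map P, 1 / 2 * b u u, B, ?_, ?_, ?_, by have := hx u hux hu0; positivity, hBυ,
    hBυ₀, ?_⟩
  · rw [← LinearMap.range_domRestrict, LinearMap.finrank_range_of_inj inj,
      Submodule.finrank_map_subtype_eq]
    have := f.finrank_range_add_finrank_ker
    rw [LinearMap.range_eq_top.2 (LinearMap.surjective hf_ne), finrank_top, finrank_self] at this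
    omega
  · rintro _ ⟨k, hk, rfl⟩ hne
    rw [hPP k hk]
    exact hx k ((hK k).1 hk).1 (by rintro rfl; simp at hne)
  · rintro _ ⟨k, hk, rfl⟩
    simp [hP, h, h₁, hb k, ((hK k).1 hk).2]
  · rw [hu_eq]
    ext y
    rw [mem_shearSpan]
    constructor
    · rintro ⟨_, ⟨k, hk, rfl⟩, r, rfl⟩
      rw [hPξ k hk]
      exact add_mem ((hK k).1 hk).1 (x.smul_mem _ hux)
    · intro hy
      have hk : y - b υ y • u ∈ K := by
        rw [hK]
        exact ⟨sub_mem hy (x.smul_mem _ hux), by simp [hb υ u, hu1]⟩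
      exact ⟨_, ⟨_, hk, rfl⟩, b υ y, by rw [hPξ _ hk]; abel⟩

/-- If the positive index is at most `n + 1`, the shear parametrisation of positive definite
`(n + 1)`-planes by triples of a positive definite `n`-plane, a positive real and a vector
is bijective. -/
theorem bijOn_shearSpan [FiniteDimensional ℝ E] (hb : ∀ x y, b x y = b y x) (h : b υ υ = 0)
    (h₀ : b υ₀ υ₀ = 0) (h₁ : b υ υ₀ = 1) {n : ℕ}
    (hne : ∀ x : Submodule ℝ E, finrank ℝ x = n + 1 → (∀ v ∈ x, v ≠ 0 → 0 < b v v) →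
      ∃ v ∈ x, b v υ ≠ 0) :
    Set.BijOn (fun t : Submodule ℝ E × ℝ × E =>
        shearSpan b υ t.2.2 (υ₀ + t.2.2 + (t.2.1 - 1 / 2 * b t.2.2 t.2.2) • υ) t.1)
      {t | finrank ℝ t.1 = n ∧ (∀ v ∈ t.1, v ≠ 0 → 0 < b v v) ∧
        (∀ v ∈ t.1, b v υ = 0 ∧ b v υ₀ = 0) ∧ 0 < t.2.1 ∧ b t.2.2 υ = 0 ∧ b t.2.2 υ₀ = 0}
      {x | finrank ℝ x = n + 1 ∧ ∀ v ∈ x, v ≠ 0 → 0 < b v v} := by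
  refine ⟨?_, ?_, ?_⟩
  · rintro ⟨S, V, B⟩ ⟨hn, hpos, hS, hV, hB, hB₀⟩
    have := shearSpan_finrank_and_posDef hb h h₀ h₁ hV hB hB₀ hpos hS
    rwa [hn] at this
  · rintro ⟨S, V, B⟩ ⟨-, hpos, hS, -, hB, hB₀⟩ ⟨S', V', B'⟩ ⟨-, -, hS', -, hB', hB₀'⟩ heq
    dsimp only at *
    have hu := vector_eq_of_shearSpan_le hb h h₁ hB hB' hpos hS hS' heq
    have hc := congrArg (fun z => b z υ₀) hu
    simp only [map_add, map_smul, LinearMap.add_apply, LinearMap.smul_apply, h₀, h₁, hB₀, hB₀',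
      smul_eq_mul, mul_one, zero_add] at hc
    have h_B : B = B' := by
      rw [hc] at hu
      simpa using hu
    subst h_B
    have h_V : V = V' := by linarith
    subst h_V
    have h_S : S = S' := le_antisymm (le_of_shearSpan_eq hb h h₁ hB hS hS' heq)
      (le_of_shearSpan_eq hb h h₁ hB hS' hS heq.symm)
    rw [h_S]
  · rintro x ⟨hn, hx⟩
    obtain ⟨S, V, B, h1, h2, h3, h4, h5, h6, h7⟩ :=
      exists_shearSpan_eq hb h h₀ h₁ hn hx (hne x hn hx)
    exact ⟨(S, V, B), ⟨h1, h2, h3, h4, h5, h6⟩, h7⟩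

end HyperbolicSplitting

/-- `pqForm` as a bilinear form. -/
noncomputable def pqBilin (p q : ℕ) : LinearMap.BilinForm ℝ (Fin (p + q) → ℝ) :=
  LinearMap.mk₂ ℝ (pqForm p q)
    (fun x y z => by
      simp only [pqForm, ← Finset.sum_add_distrib, Pi.add_apply]
      exact Finset.sum_congr rfl fun _ _ => by ring)
    (fun c x y => by
      simp only [pqForm, Finset.mul_sum, Pi.smul_apply, smul_eq_mul]
      exact Finset.sum_congr rfl fun _ _ => by ring)
    (fun x y z => by
      simp only [pqForm, ← Finset.sum_add_distrib, Pi.add_apply]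
      exact Finset.sum_congr rfl fun _ _ => by ring)
    (fun c x y => by
      simp only [pqForm, Finset.mul_sum, Pi.smul_apply, smul_eq_mul]
      exact Finset.sum_congr rfl fun _ _ => by ring)

theorem pqBilin_apply (p q : ℕ) (x y : Fin (p + q) → ℝ) : pqBilin p q x y = pqForm p q x y :=
  rfl

theorem pqForm_comm (p q : ℕ) (x y : Fin (p + q) → ℝ) : pqForm p q x y = pqForm p q y x :=
  Finset.sum_congr rfl fun _ _ => by ring

theorem eq_zero_of_pqForm_self_nonneg {p q : ℕ} {z : Fin (p + q) → ℝ}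
    (hz : ∀ i : Fin p, z (Fin.castAdd q i) = 0) (h : 0 ≤ pqForm p q z z) : z = 0 := by
  have hsum : ∑ i : Fin q, z (Fin.natAdd p i) * z (Fin.natAdd p i) ≤ 0 := by
    simpa [pqForm, Fin.sum_univ_add, hz] using h
  have hq := (Finset.sum_eq_zero_iff_of_nonneg fun i _ => mul_self_nonneg _).1
    (le_antisymm hsum (Finset.sum_nonneg fun i _ => mul_self_nonneg _))
  funext i
  induction i using Fin.addCases with
  | left i => exact hz i
  | right i => simpa using hq i (Finset.mem_univ _)

/-- A positive definite subspace of maximal dimension is not orthogonal to a nonzero null vector. -/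
theorem exists_pqForm_ne_zero_of_null {p q : ℕ} {υ : Fin (p + q) → ℝ} (hυ : pqForm p q υ υ = 0)
    (hne : υ ≠ 0) {x : Submodule ℝ (Fin (p + q) → ℝ)} (hp : finrank ℝ x = p)
    (hx : ∀ v ∈ x, v ≠ 0 → 0 < pqForm p q v v) : ∃ v ∈ x, pqForm p q v υ ≠ 0 := by
  by_contra! hcon
  let g : x × ℝ →ₗ[ℝ] (Fin p → ℝ) := (LinearMap.funLeft ℝ ℝ (Fin.castAdd q)).comp
    (x.subtype.coprod ((LinearMap.id : ℝ →ₗ[ℝ] ℝ).smulRight υ))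
  have hg : ∀ y i, g y i = (y.1 + y.2 • υ : Fin (p + q) → ℝ) (Fin.castAdd q i) := fun y i => by
    simp [g, LinearMap.funLeft_apply]
  obtain ⟨⟨v, t⟩, hy, hy0⟩ := (LinearMap.ker g).ne_bot_iff.1
    (LinearMap.ker_ne_bot_of_finrank_lt (by simp [hp]))
  have hform : pqForm p q (v + t • υ) (v + t • υ) = pqForm p q v v := by
    have hv := hcon v v.2
    simp only [← pqBilin_apply] at hv hυ ⊢
    have hv' : pqBilin p q υ v = 0 := by rw [pqBilin_apply, pqForm_comm, ← pqBilin_apply, hv]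
    simp [hv, hυ, hv']
  have hvv : 0 ≤ pqForm p q v v := by
    by_cases h_v : (v : Fin (p + q) → ℝ) = 0
    · simp [h_v, pqForm]
    · exact (hx v v.2 h_v).le
  have hz : (v + t • υ : Fin (p + q) → ℝ) = 0 :=
    eq_zero_of_pqForm_self_nonneg
      (fun i => by rw [← hg (v, t), LinearMap.mem_ker.1 hy]; rfl) (hform ▸ hvv)
  have h_v : (v : Fin (p + q) → ℝ) = 0 := by
    by_contra h_v
    have := hx v v.2 h_v
    rw [← hform, hz] at this
    simp [pqForm] at this
  have h_t : t = 0 := by simpa [h_v, hne] using hz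
  exact hy0 (Prod.ext (Subtype.ext h_v) h_t)

/-- The assignment `(Σ, V, B) ↦ span {ξ(σ) : σ ∈ Σ} ∪ {ξ₄}` with
`ξ(σ) = σ - ⟨B,σ⟩υ` and `ξ₄ = υ⁰ + B + (V - ½⟨B,B⟩)υ` is a bijection from the set of
triples of a positive definite three plane `Σ ⊆ W'`, a volume `V > 0` and a B-field
`B ∈ W'` onto the set of positive definite four planes in `ℝ^{4,4+δ}`. -/
theorem stmt5 (δ : ℕ) (υ υ0 : Fin (4 + (4 + δ)) → ℝ)
    (hυ : pqForm 4 (4 + δ) υ υ = 0) (hυ0 : pqForm 4 (4 + δ) υ0 υ0 = 0)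
    (hpair : pqForm 4 (4 + δ) υ υ0 = 1) :
    Set.BijOn
      (fun t : Submodule ℝ (Fin (4 + (4 + δ)) → ℝ) × ℝ × (Fin (4 + (4 + δ)) → ℝ) =>
        Submodule.span ℝ
          ((fun σ => σ - pqForm 4 (4 + δ) t.2.2 σ • υ) '' (t.1 : Set (Fin (4 + (4 + δ)) → ℝ)) ∪
            {υ0 + t.2.2 + (t.2.1 - (1 / 2) * pqForm 4 (4 + δ) t.2.2 t.2.2) • υ}))
      {t : Submodule ℝ (Fin (4 + (4 + δ)) → ℝ) × ℝ × (Fin (4 + (4 + δ)) → ℝ) |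
        Module.finrank ℝ t.1 = 3 ∧
        (∀ v ∈ t.1, v ≠ 0 → 0 < pqForm 4 (4 + δ) v v) ∧
        (∀ v ∈ t.1, pqForm 4 (4 + δ) v υ = 0 ∧ pqForm 4 (4 + δ) v υ0 = 0) ∧
        0 < t.2.1 ∧
        pqForm 4 (4 + δ) t.2.2 υ = 0 ∧ pqForm 4 (4 + δ) t.2.2 υ0 = 0}
      {x : Submodule ℝ (Fin (4 + (4 + δ)) → ℝ) |
        Module.finrank ℝ x = 4 ∧ ∀ v ∈ x, v ≠ 0 → 0 < pqForm 4 (4 + δ) v v} := by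
  have hne : υ ≠ 0 := by
    rintro rfl
    simp [pqForm] at hpair
  exact bijOn_shearSpan (b := pqBilin 4 (4 + δ)) (n := 3) (pqForm_comm _ _) hυ hυ0 hpair
    fun x hn hx => exists_pqForm_ne_zero_of_null hυ hne hn hx
end

section
/- Let Γ be a finitely generated free ℤ-module with a symmetric bilinear form ⟨·,·⟩ that is even (⟨x,x⟩ ∈ 2ℤ for all x), unimodular (x ↦ ⟨x,·⟩ is an isomorphism Γ → Hom(Γ,ℤ)), and whose extension to Γ⊗ℝ has signature (4,20) (i.e. Γ⊗ℝ has a 4-dimensional subspace on which the form is positive definite and a 20-dimensional subspace on which it is negative definite). If u, v, u′, v′ ∈ Γ satisfy ⟨u,u⟩ = ⟨v,v⟩ = ⟨u′,u′⟩ = ⟨v′,v′⟩ = 0 and ⟨u,v⟩ = ⟨u′,v′⟩ = 1, then there exists an automorphism φ of Γ preserving the bilinear form with φ(u) = u′ and φ(v) = v′. -/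
open TensorProduct

theorem legendre_pigeonhole {a b c : ℕ} (ha : 0 < a) (hb : 0 < b) (hc : 0 < c) (r s t : ℤ) :
    ∃ x y z : ℤ, (x ≠ 0 ∨ y ≠ 0 ∨ z ≠ 0) ∧ x ^ 2 ≤ b * c ∧ y ^ 2 ≤ a * c ∧ z ^ 2 ≤ a * b ∧
      (a : ℤ) ∣ y - r * z ∧ (b : ℤ) ∣ x - s * z ∧ (c : ℤ) ∣ x - t * y := by
  have : NeZero a := ⟨ha.ne'⟩
  have : NeZero b := ⟨hb.ne'⟩
  have : NeZero c := ⟨hc.ne'⟩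
  let box : Finset (ℕ × ℕ × ℕ) := Finset.range ((b * c).sqrt + 1) ×ˢ
    Finset.range ((a * c).sqrt + 1) ×ˢ Finset.range ((a * b).sqrt + 1)
  let F : ℕ × ℕ × ℕ → ZMod a × ZMod b × ZMod c := fun w =>
    (((w.2.1 - r * w.2.2 : ℤ) : ZMod a), ((w.1 - s * w.2.2 : ℤ) : ZMod b),
      ((w.1 - t * w.2.1 : ℤ) : ZMod c))
  have hcard : (Finset.univ : Finset (ZMod a × ZMod b × ZMod c)).card < box.card := by
    simp only [box, Finset.card_univ, Fintype.card_prod, ZMod.card, Finset.card_product,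
      Finset.card_range]
    apply lt_of_pow_lt_pow_left₀ 2 (Nat.zero_le _)
    have h1 := Nat.lt_succ_sqrt' (b * c)
    have h2 := Nat.lt_succ_sqrt' (a * c)
    have h3 := Nat.lt_succ_sqrt' (a * b)
    calc (a * (b * c)) ^ 2 = (b * c) * ((a * c) * (a * b)) := by ring
      _ < ((b * c).sqrt + 1) ^ 2 * (((a * c).sqrt + 1) ^ 2 * ((a * b).sqrt + 1) ^ 2) := by
        gcongr
      _ = _ := by ring
  obtain ⟨w, hw, w', hw', hne, heq⟩ :=
    Finset.exists_ne_map_eq_of_card_lt_of_maps_to hcard (f := F) (fun _ _ => Finset.mem_univ _)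
  have hsq : ∀ {n i j : ℕ}, i < n.sqrt + 1 → j < n.sqrt + 1 → ((i : ℤ) - j) ^ 2 ≤ n := by
    intro n i j hi hj
    have h : ((n.sqrt : ℤ)) ^ 2 ≤ n := by exact_mod_cast Nat.sqrt_le' n
    refine le_trans (sq_le_sq' ?_ ?_) h <;> omega
  simp only [box, Finset.mem_product, Finset.mem_range] at hw hw'
  simp only [F, Prod.mk.injEq, ZMod.intCast_eq_intCast_iff_dvd_sub] at heq
  refine ⟨w'.1 - w.1, w'.2.1 - w.2.1, w'.2.2 - w.2.2, ?_, ?_, ?_, ?_, ?_, ?_, ?_⟩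
  · by_contra! h
    apply hne
    ext <;> omega
  · exact_mod_cast hsq hw'.1 hw.1
  · exact_mod_cast hsq hw'.2.1 hw.2.1
  · exact_mod_cast hsq hw'.2.2 hw.2.2
  · convert heq.1 using 1; ring
  · convert heq.2.1 using 1; ring
  · convert heq.2.2 using 1; ring

/-- A form of Legendre's theorem on ternary quadratic forms. -/
theorem legendre_ternary {a b c : ℕ} (ha : 0 < a) (hb : 0 < b) (hc : 0 < c)
    (hab : a.Coprime b) (hac : a.Coprime c) (hbc : b.Coprime c) (hsq : ¬ IsSquare (a * b))
    {r s t : ℤ} (hr : (a : ℤ) ∣ b * r ^ 2 - c) (hs : (b : ℤ) ∣ a * s ^ 2 - c)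
    (ht : (c : ℤ) ∣ a * t ^ 2 + b) :
    ∃ x y z : ℤ, (x ≠ 0 ∨ y ≠ 0 ∨ z ≠ 0) ∧ a * x ^ 2 + b * y ^ 2 = c * z ^ 2 := by
  obtain ⟨x, y, z, hne, hx, hy, hz, h1, h2, h3⟩ := legendre_pigeonhole ha hb hc r s t
  have d1 : (a : ℤ) ∣ a * x ^ 2 + b * y ^ 2 - c * z ^ 2 := by
    obtain ⟨k, hk⟩ := h1; obtain ⟨m, hm⟩ := hr
    exact ⟨x ^ 2 + b * k * (y + r * z) + m * z ^ 2, by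
      linear_combination (b * (y + r * z)) * hk + z ^ 2 * hm⟩
  have d2 : (b : ℤ) ∣ a * x ^ 2 + b * y ^ 2 - c * z ^ 2 := by
    obtain ⟨k, hk⟩ := h2; obtain ⟨m, hm⟩ := hs
    exact ⟨y ^ 2 + a * k * (x + s * z) + m * z ^ 2, by
      linear_combination (a * (x + s * z)) * hk + z ^ 2 * hm⟩
  have d3 : (c : ℤ) ∣ a * x ^ 2 + b * y ^ 2 - c * z ^ 2 := by
    obtain ⟨k, hk⟩ := h3; obtain ⟨m, hm⟩ := ht
    exact ⟨-z ^ 2 + a * k * (x + t * y) + m * y ^ 2, by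
      linear_combination (a * (x + t * y)) * hk + y ^ 2 * hm⟩
  have d : (a * b * c : ℤ) ∣ a * x ^ 2 + b * y ^ 2 - c * z ^ 2 := by
    refine IsCoprime.mul_dvd ?_ (IsCoprime.mul_dvd ?_ d1 d2) d3
    · exact IsCoprime.mul_left (Nat.isCoprime_iff_coprime.2 hac) (Nat.isCoprime_iff_coprime.2 hbc)
    · exact Nat.isCoprime_iff_coprime.2 hab
  have hsqZ : ∀ k : ℤ, k ^ 2 ≠ a * b := fun k hk => hsq
    ⟨k.natAbs, by zify; rw [← sq, sq_abs, hk]⟩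
  have ha' : (0 : ℤ) < a := by exact_mod_cast ha
  have hb' : (0 : ℤ) < b := by exact_mod_cast hb
  have hc' : (0 : ℤ) < c := by exact_mod_cast hc
  have hzlt : z ^ 2 < a * b := lt_of_le_of_ne hz (hsqZ z)
  obtain ⟨k, hk⟩ := d
  have habc : (0 : ℤ) < a * b * c := by positivity
  have hax : (a : ℤ) * x ^ 2 ≤ a * b * c := by nlinarith
  have hby : (b : ℤ) * y ^ 2 ≤ a * b * c := by nlinarith
  have hcz : (c : ℤ) * z ^ 2 < a * b * c := by nlinarith
  have hk0 : -1 < k := by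
    have : (a * b * c : ℤ) * (-1) < a * b * c * k := by
      rw [← hk]; nlinarith [mul_nonneg ha'.le (sq_nonneg x), mul_nonneg hb'.le (sq_nonneg y)]
    exact lt_of_mul_lt_mul_left this habc.le
  have hk2 : k ≤ 2 := by
    have : (a * b * c : ℤ) * k ≤ a * b * c * 2 := by
      rw [← hk]; nlinarith [mul_nonneg hc'.le (sq_nonneg z)]
    exact le_of_mul_le_mul_left this habc
  interval_cases k
  · exact ⟨x, y, z, hne, by linarith⟩
  · refine ⟨x * z + b * y, y * z - a * x, z ^ 2 + a * b, Or.inr (Or.inr ?_), ?_⟩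
    · positivity
    · linear_combination (z ^ 2 + a * b) * hk
  · exfalso
    have hz0 : (c : ℤ) * z ^ 2 = 0 := by
      have := mul_nonneg hc'.le (sq_nonneg z); linarith
    have hx1 : (a : ℤ) * x ^ 2 = a * (b * c) := by linarith
    have hy1 : (b : ℤ) * y ^ 2 = b * (a * c) := by linarith
    have hx2 := mul_left_cancel₀ ha'.ne' hx1
    have hy2 := mul_left_cancel₀ hb'.ne' hy1
    have h : (x * y) ^ 2 = (a * b) * (c : ℤ) ^ 2 := by rw [mul_pow, hx2, hy2]; ring
    have hcd : (c : ℤ) ∣ x * y := (Int.pow_dvd_pow_iff two_ne_zero).1 ⟨a * b, by rw [h]; ring⟩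
    obtain ⟨m, hm⟩ := hcd
    apply hsqZ m
    rw [hm] at h
    have : (c : ℤ) ^ 2 * m ^ 2 = c ^ 2 * (a * b) := by linarith
    exact mul_left_cancel₀ (by positivity) this

theorem exists_ternary_zero {a b p : ℕ} (hp : p.Prime) (ha : 0 < a) (hb : 0 < b)
    (hab : a.Coprime b) (ha4 : a % 4 = 1) (hb2 : Odd b) (hp4 : p % 4 = 1)
    (hpa : (a : ℤ) ∣ p + b) (hpb : (b : ℤ) ∣ p - a) :
    ∃ x y z : ℤ, (x ≠ 0 ∨ y ≠ 0 ∨ z ≠ 0) ∧ a * x ^ 2 = b * y ^ 2 + p * z ^ 2 := by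
  have : Fact p.Prime := ⟨hp⟩
  have hodda : Odd a := Nat.odd_iff.2 (by omega)
  have hpac : p.Coprime a := by
    rw [← Nat.isCoprime_iff_coprime] at hab ⊢
    obtain ⟨k, hk⟩ := hpa
    have : (p : ℤ) = -b + a * k := by linarith
    rw [this]
    exact (IsCoprime.add_mul_left_left_iff).2 hab.symm.neg_left
  have hpbc : b.Coprime p := by
    rw [← Nat.isCoprime_iff_coprime] at hab ⊢
    obtain ⟨k, hk⟩ := hpb
    have : (p : ℤ) = a + b * k := by linarith
    rw [this]
    exact (IsCoprime.add_mul_left_right_iff).2 hab.symm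
  have hja : jacobiSym p a = jacobiSym b a := by
    have : jacobiSym p a = jacobiSym (-b) a := by
      apply jacobiSym.mod_left'
      exact Int.ModEq.symm ((Int.modEq_iff_dvd).2 (by simpa using hpa))
    rw [this, jacobiSym.neg _ hodda, ZMod.χ₄_nat_one_mod_four ha4, one_mul]
  have hjb : jacobiSym p b = jacobiSym a b := by
    apply jacobiSym.mod_left'
    exact Int.ModEq.symm ((Int.modEq_iff_dvd).2 hpb)
  have hj : jacobiSym (a * b : ℤ) p = 1 := by
    rw [jacobiSym.mul_left, ← jacobiSym.quadratic_reciprocity_one_mod_four hp4 hodda,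
      ← jacobiSym.quadratic_reciprocity_one_mod_four hp4 hb2, hja, hjb,
      jacobiSym.quadratic_reciprocity_one_mod_four ha4 hb2, ← sq]
    exact jacobiSym.sq_one (by simpa using hab.symm)
  obtain ⟨m, hm⟩ : IsSquare ((a * b : ℤ) : ZMod p) := ZMod.isSquare_of_jacobiSym_eq_one hj
  have hb0 : (b : ZMod p) ≠ 0 := by
    intro h
    rw [ZMod.natCast_eq_zero_iff] at h
    exact (hp.coprime_iff_not_dvd.1 hpbc.symm) h
  obtain ⟨s, hs⟩ := ZMod.intCast_surjective (m / (b : ZMod p))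
  have hsdvd : (p : ℤ) ∣ b * s ^ 2 - a := by
    rw [← ZMod.intCast_zmod_eq_zero_iff_dvd]
    push_cast at hm ⊢
    rw [hs]
    field_simp
    linear_combination -hm
  have hnsq : ¬ IsSquare (b * p) := by
    rintro ⟨k, hk⟩
    obtain ⟨j, rfl⟩ : p ∣ k := by
      rcases hp.dvd_mul.1 (hk ▸ dvd_mul_left p b) with h | h <;> exact h
    have : b = p * (j * j) := by
      apply Nat.eq_of_mul_eq_mul_right hp.pos; rw [hk]; ring
    exact (hp.coprime_iff_not_dvd.1 hpbc.symm) ⟨_, this⟩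
  obtain ⟨x, y, z, hne, h⟩ := legendre_ternary hb hp.pos ha hpbc hab.symm hpac hnsq
    (r := 1) (s := s) (t := 1) (by simpa using hpb) hsdvd (by simpa [add_comm] using hpa)
  exact ⟨z, x, y, by tauto, by linarith⟩

theorem exists_int_congr {m n : ℤ} (h : IsCoprime m n) (i j : ℤ) :
    ∃ k : ℤ, m ∣ k - i ∧ n ∣ k - j := by
  obtain ⟨r, s, hrs⟩ := h
  exact ⟨i * (s * n) + j * (r * m), ⟨(j - i) * r, by linear_combination i * hrs⟩,
    ⟨(i - j) * s, by linear_combination j * hrs⟩⟩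

theorem isCoprime_of_dvd_sub {m k i : ℤ} (h : m ∣ k - i) (hi : IsCoprime i m) :
    IsCoprime k m := by
  obtain ⟨r, hr⟩ := h
  rw [show k = i + m * r by linarith]
  exact IsCoprime.add_mul_left_left_iff.2 hi

theorem exists_common_prime {a b c d : ℕ} (hab : a.Coprime b)
    (hac : a.Coprime c) (had : a.Coprime d) (hbc : b.Coprime c) (hbd : b.Coprime d)
    (hcd : c.Coprime d) (ha : Odd a) (hb : Odd b) (hc : Odd c) (hd : Odd d) :
    ∃ p : ℕ, p.Prime ∧ p % 4 = 1 ∧ (a : ℤ) ∣ p + b ∧ (b : ℤ) ∣ p - a ∧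
      (d : ℤ) ∣ p + c ∧ (c : ℤ) ∣ p - d := by
  have h4 : ∀ {n : ℕ}, Odd n → IsCoprime (n : ℤ) 4 := fun {n} hn => by
    have : Nat.Coprime n (2 ^ 2) := (Nat.coprime_two_right.2 hn).pow_right 2
    exact_mod_cast Nat.isCoprime_iff_coprime.2 this
  rw [← Nat.isCoprime_iff_coprime] at hab hac had hbc hbd hcd
  obtain ⟨k₁, hk1a, hk1b⟩ := exists_int_congr hab (-b) a
  obtain ⟨k₂, hk2d, hk2c⟩ := exists_int_congr hcd.symm (-c) d
  obtain ⟨k₃, hk31, hk32⟩ := exists_int_congr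
    (IsCoprime.mul_left (had.mul_right hac) (hbd.mul_right hbc)) k₁ k₂
  obtain ⟨k, hk3, hk4⟩ := exists_int_congr
    (((h4 ha).mul_left (h4 hb)).mul_left ((h4 hd).mul_left (h4 hc))) k₃ 1
  have tr : ∀ {m x y z : ℤ}, m ∣ x - y → m ∣ y - z → m ∣ x - z := fun h h' => by
    simpa using dvd_add h h'
  have hka : (a : ℤ) ∣ k - -b := tr (tr (((dvd_mul_right _ _).mul_right _).trans hk3)
    ((dvd_mul_right _ _).trans hk31)) hk1a
  have hkb : (b : ℤ) ∣ k - a := tr (tr (((dvd_mul_left _ _).mul_right _).trans hk3)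
    ((dvd_mul_left _ _).trans hk31)) hk1b
  have hkd : (d : ℤ) ∣ k - -c := tr (tr (((dvd_mul_right _ _).mul_left _).trans hk3)
    ((dvd_mul_right _ _).trans hk32)) hk2d
  have hkc : (c : ℤ) ∣ k - d := tr (tr (((dvd_mul_left _ _).mul_left _).trans hk3)
    ((dvd_mul_left _ _).trans hk32)) hk2c
  have hcop : IsCoprime k ((4 * a * b * c * d : ℕ) : ℤ) := by
    push_cast
    refine IsCoprime.mul_right (IsCoprime.mul_right (IsCoprime.mul_right (IsCoprime.mul_right
      ?_ ?_) ?_) ?_) ?_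
    · exact isCoprime_of_dvd_sub hk4 isCoprime_one_left
    · exact isCoprime_of_dvd_sub hka hab.symm.neg_left
    · exact isCoprime_of_dvd_sub hkb hab
    · exact isCoprime_of_dvd_sub hkc hcd.symm
    · exact isCoprime_of_dvd_sub hkd hcd.neg_left
  have : NeZero (4 * a * b * c * d) := ⟨by
    have := ha.pos; have := hb.pos; have := hc.pos; have := hd.pos; positivity⟩
  have hu : IsUnit ((k : ℤ) : ZMod (4 * a * b * c * d)) := by
    obtain ⟨r, s, hrs⟩ := hcop
    have := congrArg (Int.cast : ℤ → ZMod (4 * a * b * c * d)) hrs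
    rw [Int.cast_add, Int.cast_mul, Int.cast_mul, Int.cast_natCast (4 * a * b * c * d),
      ZMod.natCast_self, mul_zero, add_zero, Int.cast_one] at this
    exact IsUnit.of_mul_eq_one_right _ this
  obtain ⟨p, -, hp, hpk⟩ := Nat.forall_exists_prime_gt_and_eq_mod hu 0
  have hdvd : ((4 * a * b * c * d : ℕ) : ℤ) ∣ p - k := by
    rw [← Int.cast_natCast, eq_comm, ZMod.intCast_eq_intCast_iff_dvd_sub] at hpk
    exact hpk
  push_cast at hdvd
  refine ⟨p, hp, ?_, ?_, ?_, ?_, ?_⟩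
  · have : (4 : ℤ) ∣ p - 1 := tr (Dvd.dvd.trans ⟨a * b * c * d, by ring⟩ hdvd) hk4
    omega
  · simpa using tr (Dvd.dvd.trans ⟨4 * b * c * d, by ring⟩ hdvd) hka
  · exact tr (Dvd.dvd.trans ⟨4 * a * c * d, by ring⟩ hdvd) hkb
  · simpa using tr (Dvd.dvd.trans ⟨4 * a * b * c, by ring⟩ hdvd) hkd
  · exact tr (Dvd.dvd.trans ⟨4 * a * b * d, by ring⟩ hdvd) hkc

theorem exists_quaternary_zero {a b c d : ℕ} (hab : a.Coprime b)
    (hac : a.Coprime c) (had : a.Coprime d) (hbc : b.Coprime c) (hbd : b.Coprime d)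
    (hcd : c.Coprime d) (ha : a % 4 = 1) (hb : Odd b) (hc : Odd c) (hd : d % 4 = 1) :
    ∃ x y z w : ℤ, (x ≠ 0 ∨ y ≠ 0 ∨ z ≠ 0 ∨ w ≠ 0) ∧
      a * x ^ 2 - b * y ^ 2 + c * z ^ 2 - d * w ^ 2 = 0 := by
  have ha' : Odd a := Nat.odd_iff.2 (by omega)
  have hd' : Odd d := Nat.odd_iff.2 (by omega)
  obtain ⟨p, hp, hp4, hpa, hpb, hpd, hpc⟩ :=
    exists_common_prime hab hac had hbc hbd hcd ha' hb hc hd'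
  obtain ⟨x, y, s, hne, hxy⟩ := exists_ternary_zero hp ha'.pos hb.pos hab ha hb hp4 hpa hpb
  obtain ⟨w, z, t, hne', hwz⟩ :=
    exists_ternary_zero hp hd'.pos hc.pos hcd.symm hd hc hp4 hpd hpc
  by_cases hs : s = 0
  · subst hs
    exact ⟨x, y, 0, 0, by simpa using hne, by linear_combination hxy⟩
  by_cases ht : t = 0
  · subst ht
    exact ⟨0, 0, z, w, by simpa [or_comm] using hne', by linear_combination -hwz⟩
  refine ⟨t * x, t * y, s * z, s * w, ?_, by
    linear_combination t ^ 2 * hxy - s ^ 2 * hwz⟩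
  by_contra! h
  simp only [mul_eq_zero, hs, ht, false_or] at h
  obtain ⟨rfl, rfl, -, -⟩ := h
  exact hs (by simpa [show p ≠ 0 from hp.ne_zero] using hxy.symm)

section Orbits

variable {Γ : Type*} [AddCommGroup Γ]

/-- Two vectors are related when an isometry of the lattice takes the first to the second. -/
def SameOrbit (B : Γ →ₗ[ℤ] Γ →ₗ[ℤ] ℤ) (x y : Γ) : Prop :=
  ∃ φ : Γ ≃ₗ[ℤ] Γ, (∀ z w, B (φ z) (φ w) = B z w) ∧ φ x = y

variable {B : Γ →ₗ[ℤ] Γ →ₗ[ℤ] ℤ}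

theorem SameOrbit.symm {x y : Γ} (h : SameOrbit B x y) : SameOrbit B y x := by
  obtain ⟨φ, hφ, rfl⟩ := h
  exact ⟨φ.symm, fun z w => by rw [← hφ]; simp, by simp⟩

theorem SameOrbit.trans {x y z : Γ} (h : SameOrbit B x y) (h' : SameOrbit B y z) :
    SameOrbit B x z := by
  obtain ⟨φ, hφ, rfl⟩ := h
  obtain ⟨ψ, hψ, rfl⟩ := h'
  exact ⟨φ.trans ψ, fun z w => by simp [hψ, hφ], by simp⟩

theorem SameOrbit.neg (x : Γ) : SameOrbit B x (-x) :=
  ⟨LinearEquiv.neg ℤ, fun z w => by simp, by simp⟩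

/-- Reflection in a vector of norm `-2`. -/
theorem exists_reflection (hsymm : ∀ x y, B x y = B y x) {r : Γ} (hr : B r r = -2) :
    ∃ φ : Γ ≃ₗ[ℤ] Γ, (∀ z w, B (φ z) (φ w) = B z w) ∧ ∀ z, φ z = z + B z r • r := by
  let f : Γ →ₗ[ℤ] Γ := LinearMap.id + (B.flip r).smulRight r
  have hf : ∀ z, f z = z + B z r • r := fun z => by simp [f]
  have hinv : Function.Involutive f := fun z => by
    rw [hf, hf]
    simp only [map_add, map_smul, LinearMap.add_apply, LinearMap.smul_apply, hr, smul_eq_mul]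
    module
  refine ⟨LinearEquiv.ofInvolutive f hinv, fun z w => ?_, hf⟩
  simp only [LinearEquiv.coe_ofInvolutive, hf, map_add, map_smul, LinearMap.add_apply,
    LinearMap.smul_apply, hr, smul_eq_mul]
  rw [hsymm r w]
  ring

theorem sameOrbit_of_apply_eq_one (hsymm : ∀ x y, B x y = B y x) {x y : Γ} (hx : B x x = 0)
    (hy : B y y = 0) (hxy : B x y = 1) : SameOrbit B x y := by
  have hyx : B y x = 1 := by rw [hsymm, hxy]
  obtain ⟨φ, hφ, h⟩ := exists_reflection hsymm (r := x - y) (by simp [hx, hy, hxy, hyx])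
  exact ⟨φ, hφ, by rw [h]; simp [hx, hxy]⟩

/-- Eichler transvections. -/
theorem exists_transvection (hsymm : ∀ x y, B x y = B y x) {e w : Γ} {q : ℤ} (he : B e e = 0)
    (hew : B e w = 0) (hq : B w w = 2 * q) :
    ∃ φ : Γ ≃ₗ[ℤ] Γ, (∀ z w, B (φ z) (φ w) = B z w) ∧
      ∀ z, φ z = z + B z e • w - B z w • e - (q * B z e) • e := by
  have hwe : B w e = 0 := by rw [hsymm, hew]
  let f : Γ → Γ →ₗ[ℤ] Γ := fun w => LinearMap.id + (B.flip e).smulRight w -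
    (B.flip w).smulRight e - (q • B.flip e).smulRight e
  have hf : ∀ w z, f w z = z + B z e • w - B z w • e - (q * B z e) • e := fun w z => by simp [f]
  refine ⟨LinearEquiv.ofLinearMap (f w) (f (-w)) ?_ ?_, fun z z' => ?_, hf w⟩
  · ext z
    simp only [LinearMap.comp_apply, hf, map_add, map_sub, map_neg, map_smul, LinearMap.add_apply,
      LinearMap.sub_apply, LinearMap.neg_apply, LinearMap.smul_apply, he, hew, hwe, hq,
      smul_eq_mul, LinearMap.id_apply]
    module
  · ext z
    simp only [LinearMap.comp_apply, hf, map_add, map_sub, map_neg, map_smul, LinearMap.add_apply,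
      LinearMap.sub_apply, LinearMap.smul_apply, he, hew, hwe, hq,
      smul_eq_mul, LinearMap.id_apply]
    module
  · simp only [LinearEquiv.coe_ofLinearMap, hf, map_add, map_sub, map_smul, LinearMap.add_apply,
      LinearMap.sub_apply, LinearMap.smul_apply, he, hew, hwe, hq, smul_eq_mul]
    rw [hsymm e z', hsymm w z']
    ring

/-- Eichler's criterion: in an even lattice containing two orthogonal hyperbolic planes all
null vectors `x` with `⟨x, Γ⟩ = ℤ` are equivalent. -/
theorem sameOrbit_of_two_hyperbolic_planes (hsymm : ∀ x y, B x y = B y x)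
    (heven : ∀ x, ∃ n : ℤ, B x x = 2 * n) {u v e f x x' : Γ}
    (huu : B u u = 0) (hvv : B v v = 0) (huv : B u v = 1)
    (hee : B e e = 0) (hff : B f f = 0) (hef : B e f = 1)
    (hue : B u e = 0) (huf : B u f = 0) (hve : B v e = 0) (hvf : B v f = 0)
    (hx : B x x = 0) (hxx' : B x x' = 1) : SameOrbit B x e := by
  have hvu : B v u = 1 := by rw [hsymm, huv]
  have hfe : B f e = 1 := by rw [hsymm, hef]
  have heu : B e u = 0 := by rw [hsymm, hue]
  have hfu : B f u = 0 := by rw [hsymm, huf]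
  have hev : B e v = 0 := by rw [hsymm, hve]
  have hfv : B f v = 0 := by rw [hsymm, hvf]
  have adj : ∀ {y z : Γ}, B y y = 0 → B z z = 0 → B y z = 1 → SameOrbit B y z :=
    fun h h' h'' => sameOrbit_of_apply_eq_one hsymm h h' h''
  have hfO : SameOrbit B f e := adj hff hee hfe
  have huO : SameOrbit B u e := (adj (y := u) (z := v + f) huu (by simp [*]) (by simp [*])).trans
    (adj (by simp [*]) hee (by simp [*]))
  have hvO : SameOrbit B v e := (adj hvv huu hvu).trans huO
  have hwt : ∀ (w : Γ) (q t : ℤ), B w w = 2 * q → B u w = 0 → B v w = 0 → B e w = 0 →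
      SameOrbit B (v + w - q • u + t • e) e := fun w q t hw h1 h2 h3 => by
    have h1' : B w u = 0 := by rw [hsymm, h1]
    have h2' : B w v = 0 := by rw [hsymm, h2]
    have h3' : B w e = 0 := by rw [hsymm, h3]
    refine (adj ?_ huu ?_).trans huO
    · simp [*]; ring
    · simp [*]
  have hut : ∀ t : ℤ, SameOrbit B (u + t • e) e := fun t =>
    (adj (by simp [*]) hvv (by simp [*])).trans hvO
  have hfab : ∀ α β : ℤ, SameOrbit B (f + α • u + β • v - (α * β) • e) e := fun α β => by
    refine adj ?_ hee ?_
    · simp [*]; ring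
    · simp [*]
  -- decomposition of an arbitrary vector
  have hdecomp : ∀ y, ∃ w, B u w = 0 ∧ B v w = 0 ∧ B e w = 0 ∧
      y = B y v • u + B y u • v + B y f • e + B y e • f + w := fun y =>
    ⟨y - B y v • u - B y u • v - B y f • e - B y e • f, by
      simp [huu, huv, hue, huf, hsymm u y], by simp [hvu, hvv, hve, hvf, hsymm v y], by
      simp [heu, hev, hee, hef, hsymm e y], by module⟩
  have hex : ∃ n : ℕ, 0 < n ∧ ∃ y, SameOrbit B x y ∧ B y e = n := by
    by_contra! hcon
    have hle : ∀ y, SameOrbit B y e → B x y ≤ 0 := fun y ⟨φ, hφ, hy⟩ => by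
      by_contra! hlt
      obtain ⟨n, hn⟩ := Int.eq_ofNat_of_zero_le hlt.le
      refine hcon n (by omega) (φ x) ⟨φ, hφ, rfl⟩ ?_
      rw [← hy, hφ, hn]
    have hzero : ∀ y, SameOrbit B y e → B x y = 0 := fun y hy => by
      have h1 := hle y hy
      have h2 := hle (-y) ((SameOrbit.neg y).symm.trans hy)
      rw [map_neg] at h2
      omega
    obtain ⟨w, h1, h2, h3, hw⟩ := hdecomp x'
    obtain ⟨q, hq⟩ := heven w
    have h4 := hzero _ (hwt w q 0 hq h1 h2 h3)
    have hxu := hzero u huO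
    have hxv := hzero v hvO
    have hxf := hzero f hfO
    have hxe := hzero e ⟨LinearEquiv.refl ℤ Γ, fun _ _ => rfl, rfl⟩
    simp only [map_add, map_sub, map_smul, hxu, hxv, hxe, smul_eq_mul, mul_zero] at h4
    rw [hw] at hxx'
    simp only [map_add, map_smul, hxu, hxv, hxe, hxf, smul_eq_mul, mul_zero] at hxx'
    omega
  classical
  obtain ⟨hd, x₁, hx₁, hd₁⟩ := Nat.find_spec hex
  have hmin : ∀ y, SameOrbit B y e → 0 < B x₁ y → (Nat.find hex : ℤ) ≤ B x₁ y :=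
    fun y ⟨φ, hφ, hy⟩ hpos => by
      obtain ⟨n, hn⟩ := Int.eq_ofNat_of_zero_le hpos.le
      have : Nat.find hex ≤ n := Nat.find_min' hex
        ⟨by omega, φ x₁, hx₁.trans ⟨φ, hφ, rfl⟩, by rw [← hy, hφ, hn]⟩
      omega
  set d : ℤ := (Nat.find hex : ℤ) with hd_def
  have hdpos : 0 < d := by omega
  have hdvd_of : ∀ m, (∃ y t, SameOrbit B y e ∧ B x₁ y = m + t * d ∧ 0 ≤ m + t * d ∧
      m + t * d < d) → d ∣ m := by
    rintro m ⟨y, t, hy, hy', h0, h1⟩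
    rcases h0.eq_or_lt with h | h
    · exact ⟨-t, by linarith⟩
    · have := hmin y hy (by omega); omega
  have hdvd_t : ∀ y, (∀ t : ℤ, SameOrbit B (y + t • e) e) →
      d ∣ B x₁ y := fun y hy => by
    refine hdvd_of _ ⟨_, -(B x₁ y / d), hy (-(B x₁ y / d)), by simp [hd₁], ?_, ?_⟩
    · have := Int.emod_nonneg (B x₁ y) hdpos.ne'
      rw [Int.emod_def] at this; linarith
    · have := Int.emod_lt_of_pos (B x₁ y) hdpos
      rw [Int.emod_def] at this; linarith
  have du : d ∣ B x₁ u := hdvd_t u hut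
  have dv : d ∣ B x₁ v := hdvd_t v fun t => by
    simpa using hwt 0 0 t (by simp) (by simp) (by simp) (by simp)
  have de : d ∣ B x₁ e := by rw [hd₁]
  have df : d ∣ B x₁ f := by
    obtain ⟨a, ha⟩ := dv
    obtain ⟨b, hb⟩ := du
    have key : ∀ s : ℤ, ∃ α β : ℤ, α * b + β * a - α * β = s := fun s =>
      ⟨a + 1, a * b + b - s, by ring⟩
    obtain ⟨α, β, h⟩ := key (-(B x₁ f / d))
    refine hdvd_of _ ⟨_, -(B x₁ f / d), hfab α β, ?_, ?_, ?_⟩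
    · simp only [map_add, map_sub, map_smul, smul_eq_mul, hd₁, ha, hb]
      linear_combination d * h
    · have := Int.emod_nonneg (B x₁ f) hdpos.ne'
      rw [Int.emod_def] at this; linarith
    · have := Int.emod_lt_of_pos (B x₁ f) hdpos
      rw [Int.emod_def] at this; linarith
  have dall : ∀ y, d ∣ B x₁ y := fun y => by
    obtain ⟨w, h1, h2, h3, hw⟩ := hdecomp y
    obtain ⟨q, hq⟩ := heven w
    have h4 := hdvd_t _ fun t => hwt w q t hq h1 h2 h3
    have dw : d ∣ B x₁ w := by
      have : B x₁ w = B x₁ (v + w - q • u) - B x₁ v + q * B x₁ u := by simp; ring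
      rw [this]
      exact dvd_add (dvd_sub h4 dv) (dvd_mul_of_dvd_right du _)
    rw [hw]
    simp only [map_add, map_smul, smul_eq_mul]
    exact dvd_add (dvd_add (dvd_add (dvd_add (dvd_mul_of_dvd_right du _)
      (dvd_mul_of_dvd_right dv _)) (dvd_mul_of_dvd_right de _)) (dvd_mul_of_dvd_right df _)) dw
  obtain ⟨φ, hφ, hφx⟩ := hx₁
  have h1 : d ∣ 1 := by rw [← hxx', ← hφ, hφx]; exact dall _
  have hd1 : d = 1 := Int.eq_one_of_dvd_one hdpos.le h1
  refine SameOrbit.trans ⟨φ, hφ, hφx⟩ (adj ?_ hee (by rw [hd₁, hd1]))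
  rw [← hφx, hφ, hx]

end Orbits

section Lattice

variable {Γ : Type*} [AddCommGroup Γ]

/-- The sublattice orthogonal to a finite family of vectors. -/
def orthLattice (B : Γ →ₗ[ℤ] Γ →ₗ[ℤ] ℤ) {k : ℕ} (S : Fin k → Γ) : Submodule ℤ Γ :=
  LinearMap.ker (LinearMap.pi fun i => B (S i))

variable {B : Γ →ₗ[ℤ] Γ →ₗ[ℤ] ℤ}

theorem mem_orthLattice {k : ℕ} {S : Fin k → Γ} {x : Γ} :
    x ∈ orthLattice B S ↔ ∀ i, B (S i) x = 0 := by
  simp [orthLattice, funext_iff]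

theorem finrank_le_finrank_ker_add [Module.Free ℤ Γ] [Module.Finite ℤ Γ] {k : ℕ}
    (ψ : Γ →ₗ[ℤ] (Fin k → ℤ)) :
    Module.finrank ℤ (LinearMap.range ψ) ≤ k ∧
    Module.finrank ℤ Γ = Module.finrank ℤ (LinearMap.ker ψ) +
      Module.finrank ℤ (LinearMap.range ψ) := by
  constructor
  · simpa using Submodule.finrank_le (LinearMap.range ψ)
  · rw [← Submodule.finrank_quotient_add_finrank (LinearMap.ker ψ),
      ψ.quotKerEquivRange.finrank_eq, add_comm]

theorem finrank_le_finrank_orthLattice_add [Module.Free ℤ Γ] [Module.Finite ℤ Γ] {k : ℕ}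
    (S : Fin k → Γ) : Module.finrank ℤ Γ ≤ Module.finrank ℤ (orthLattice B S) + k := by
  have := finrank_le_finrank_ker_add (LinearMap.pi fun i => B (S i))
  unfold orthLattice
  omega

/-- The orthogonal complement of few vectors in a unimodular lattice is not totally isotropic
modulo any prime. -/
theorem exists_not_dvd_of_orthLattice [Module.Free ℤ Γ] [Module.Finite ℤ Γ]
    (hunimod : Function.Bijective fun x : Γ => B x) {k : ℕ} (S : Fin k → Γ)
    (hk : 2 * k < Module.finrank ℤ Γ) {l : ℕ} (hl : l.Prime) :
    ∃ y ∈ orthLattice B S, ∃ z ∈ orthLattice B S, ¬ (l : ℤ) ∣ B y z := by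
  by_contra! hcon
  have : Fact l.Prime := ⟨hl⟩
  set ψ : Γ →ₗ[ℤ] (Fin k → ℤ) := LinearMap.pi fun i => B (S i) with hψ
  change ∀ y ∈ LinearMap.ker ψ, ∀ z ∈ LinearMap.ker ψ, (l : ℤ) ∣ B y z at hcon
  obtain ⟨hr1, hr2⟩ := finrank_le_finrank_ker_add ψ
  obtain ⟨σ, hσ⟩ := Module.projective_lifting_property ψ.rangeRestrict LinearMap.id
    ψ.surjective_rangeRestrict
  have hσ' : ∀ x, ψ (σ x) = x := fun x => congrArg Subtype.val (LinearMap.congr_fun hσ x)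
  have hker : ∀ x, x - σ (ψ.rangeRestrict x) ∈ LinearMap.ker ψ := fun x => by
    rw [LinearMap.mem_ker, map_sub, hσ']; simp
  let pr : Γ →ₗ[ℤ] LinearMap.ker ψ :=
    LinearMap.codRestrict _ (LinearMap.id - σ ∘ₗ ψ.rangeRestrict) hker
  have hpr : ∀ x : LinearMap.ker ψ, pr x = x := fun x => by
    ext
    have : ψ.rangeRestrict x = 0 := by ext1; exact x.2
    simp [pr, this]
  let b := Module.finBasis ℤ (LinearMap.ker ψ)
  let c := Module.finBasis ℤ (LinearMap.range ψ)
  let T : Γ →+ (Fin (Module.finrank ℤ (LinearMap.ker ψ)) → ZMod l) :=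
    { toFun := fun x i => ((B x (b i) : ℤ) : ZMod l)
      map_zero' := by ext; simp
      map_add' := fun x y => by ext; simp }
  have hTker : ∀ x ∈ LinearMap.ker ψ, T x = 0 := fun x hx => by
    ext i
    exact (ZMod.intCast_zmod_eq_zero_iff_dvd _ _).2 (hcon x hx _ (b i).2)
  have hspan : Submodule.span (ZMod l) (Set.range fun j => T (σ (c j))) = ⊤ := by
    rw [eq_top_iff]
    rintro w -
    choose w' hw' using fun i => ZMod.intCast_surjective (w i)
    obtain ⟨x, hx⟩ := hunimod.2 ((b.constr ℤ w') ∘ₗ pr)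
    have hTx : T x = w := by
      ext i
      change ((B x (b i) : ℤ) : ZMod l) = w i
      simp only at hx
      rw [hx, LinearMap.comp_apply, hpr, Module.Basis.constr_basis, hw']
    have hT2 : T x = T (σ (ψ.rangeRestrict x)) := by
      have := hTker _ (hker x)
      rwa [map_sub, sub_eq_zero] at this
    rw [← hTx, hT2, ← c.sum_repr (ψ.rangeRestrict x), map_sum, map_sum]
    refine Submodule.sum_mem _ fun j _ => ?_
    rw [map_smul, map_zsmul, ← Int.cast_smul_eq_zsmul (ZMod l)]
    exact Submodule.smul_mem _ _ (Submodule.subset_span ⟨j, rfl⟩)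
  have h1 := finrank_range_le_card (R := ZMod l) fun j => T (σ (c j))
  rw [Set.finrank, hspan, finrank_top, Module.finrank_fin_fun, Fintype.card_fin] at h1
  omega

/-- A sublattice whose rank forces its real span to meet a positive definite subspace contains
vectors of positive norm. -/
theorem exists_pos_of_finrank [Module.Free ℤ Γ] [Module.Finite ℤ Γ]
    {Bℝ : (ℝ ⊗[ℤ] Γ) →ₗ[ℝ] (ℝ ⊗[ℤ] Γ) →ₗ[ℝ] ℝ}
    (hBℝ : ∀ x y : Γ, Bℝ ((1 : ℝ) ⊗ₜ[ℤ] x) ((1 : ℝ) ⊗ₜ[ℤ] y) = (B x y : ℝ))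
    {P : Submodule ℝ (ℝ ⊗[ℤ] Γ)} (hP : ∀ z ∈ P, z ≠ 0 → 0 < Bℝ z z) {L : Submodule ℤ Γ}
    (hL : Module.finrank ℤ Γ < Module.finrank ℤ L + Module.finrank ℝ P) :
    ∃ y ∈ L, 0 < B y y := by
  by_contra! hcon
  let ι : (ℝ ⊗[ℤ] L) →ₗ[ℝ] (ℝ ⊗[ℤ] Γ) := L.subtype.baseChange ℝ
  have hι : Function.Injective ι :=
    Module.Flat.lTensor_preserves_injective_linearMap (M := ℝ) L.subtype L.injective_subtype
  have hfr : Module.finrank ℝ (LinearMap.range ι) = Module.finrank ℤ L := by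
    rw [LinearMap.finrank_range_of_inj hι, Module.finrank_baseChange]
  have hdim := Submodule.finrank_sup_add_finrank_inf_eq (LinearMap.range ι) P
  have hsup := Submodule.finrank_le (LinearMap.range ι ⊔ P)
  rw [Module.finrank_baseChange] at hsup
  have hpos : 0 < Module.finrank ℝ (LinearMap.range ι ⊓ P : Submodule ℝ (ℝ ⊗[ℤ] Γ)) := by omega
  obtain ⟨z, hz0⟩ := @exists_ne _ (Module.nontrivial_of_finrank_pos hpos) 0
  obtain ⟨⟨z, ⟨t, rfl⟩, hzP⟩, hz0⟩ : ∃ z : (LinearMap.range ι ⊓ P : Submodule ℝ (ℝ ⊗[ℤ] Γ)),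
    z ≠ 0 := ⟨z, hz0⟩
  have hzpos := hP _ hzP (fun h => hz0 (Subtype.ext h))
  let b := Module.finBasis ℤ L
  let g : (Fin (Module.finrank ℤ L) → ℝ) → ℝ := fun c =>
    ∑ i, ∑ j, c i * c j * (B (b i) (b j) : ℝ)
  have hgι : ∀ c : Fin (Module.finrank ℤ L) → ℝ,
      Bℝ (ι (∑ i, c i • ((1 : ℝ) ⊗ₜ[ℤ] b i))) (ι (∑ i, c i • ((1 : ℝ) ⊗ₜ[ℤ] b i))) = g c := by
    intro c
    simp only [map_sum, map_smul, LinearMap.sum_apply, LinearMap.smul_apply, smul_eq_mul, ι,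
      LinearMap.baseChange_tmul, Submodule.subtype_apply, hBℝ, g, Finset.mul_sum]
    rw [Finset.sum_comm]
    exact Finset.sum_congr rfl fun _ _ => Finset.sum_congr rfl fun _ _ => by ring
  have hgint : ∀ c : Fin (Module.finrank ℤ L) → ℤ, g (fun i => c i) ≤ 0 := fun c => by
    have h := hcon _ (∑ i, c i • b i).2
    have : g (fun i => (c i : ℝ)) =
        ((B (∑ i, c i • b i : L) (∑ i, c i • b i : L) : ℤ) : ℝ) := by
      simp only [Submodule.coe_sum, Submodule.coe_smul, map_sum, map_smul, LinearMap.sum_apply,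
        LinearMap.smul_apply, smul_eq_mul, g, Finset.mul_sum, Int.cast_sum, Int.cast_mul]
      rw [Finset.sum_comm]
      exact Finset.sum_congr rfl fun _ _ => Finset.sum_congr rfl fun _ _ => by ring
    rw [this]
    exact_mod_cast h
  have hgrat : ∀ c : Fin (Module.finrank ℤ L) → ℚ, g (fun i => c i) ≤ 0 := fun c => by
    obtain ⟨d, hd⟩ := IsLocalization.exist_integer_multiples_of_finite (nonZeroDivisors ℤ) c
    choose m hm using hd
    have hd0 : (0 : ℝ) < ((d : ℤ) : ℝ) ^ 2 := by
      have : (d : ℤ) ≠ 0 := nonZeroDivisors.coe_ne_zero d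
      positivity
    have hmr : ∀ i, (m i : ℝ) = ((d : ℤ) : ℝ) * c i := fun i => by
      have := hm i
      simp only [algebraMap_int_eq, eq_intCast, zsmul_eq_mul] at this
      exact_mod_cast this
    have h := hgint m
    have : g (fun i => (m i : ℝ)) = ((d : ℤ) : ℝ) ^ 2 * g (fun i => c i) := by
      simp only [g, hmr, Finset.mul_sum]
      exact Finset.sum_congr rfl fun _ _ => Finset.sum_congr rfl fun _ _ => by ring
    rw [this] at h
    exact nonpos_of_mul_nonpos_right h hd0
  have hgreal : ∀ c, g c ≤ 0 := by
    have hdense : DenseRange (Pi.map fun (_ : Fin (Module.finrank ℤ L)) (r : ℚ) => (r : ℝ)) :=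
      DenseRange.piMap fun _ => Rat.denseRange_cast
    have hcont : Continuous g := by fun_prop
    exact fun c => hdense.induction_on (p := fun c => g c ≤ 0) c
      (isClosed_le hcont continuous_const) hgrat
  have ht : t = ∑ i, (b.baseChange ℝ).repr t i • ((1 : ℝ) ⊗ₜ[ℤ] b i) := by
    conv_lhs => rw [← (b.baseChange ℝ).sum_repr t]
    simp
  rw [ht, hgι] at hzpos
  exact absurd hzpos (hgreal _).not_gt

variable {q : Γ → ℤ}

theorem q_combination (hsymm : ∀ x y, B x y = B y x) (hq : ∀ x, B x x = 2 * q x) (α β : ℤ)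
    (x y : Γ) : q (α • x + β • y) = α ^ 2 * q x + α * β * B x y + β ^ 2 * q y := by
  have h := hq (α • x + β • y)
  simp only [map_add, map_smul, LinearMap.add_apply, LinearMap.smul_apply, smul_eq_mul, hq,
    hsymm y x] at h
  linarith

theorem exists_not_dvd_q (hsymm : ∀ x y, B x y = B y x) (hq : ∀ x, B x x = 2 * q x)
    {L : Submodule ℤ Γ} {l : ℤ} (h : ∃ y ∈ L, ∃ z ∈ L, ¬ l ∣ B y z) : ∃ x ∈ L, ¬ l ∣ q x := by
  by_contra! hcon
  obtain ⟨y, hy, z, hz, hyz⟩ := h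
  have h := q_combination hsymm hq 1 1 y z
  have h1 := hcon _ (L.add_mem (L.smul_mem 1 hy) (L.smul_mem 1 hz))
  apply hyz
  have : B y z = q ((1 : ℤ) • y + (1 : ℤ) • z) - q y - q z := by rw [h]; ring
  rw [this]
  exact dvd_sub (dvd_sub h1 (hcon y hy)) (hcon z hz)

theorem binary_represents_odd_mod_four : ∀ a b c ε : ZMod 4, b * b = 1 → ε * ε = 1 →
    ∃ s t : ZMod 4, s ^ 2 * a + s * t * b + t ^ 2 * c = ε := by
  decide

theorem exists_q_mod_four (hsymm : ∀ x y, B x y = B y x) (hq : ∀ x, B x x = 2 * q x)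
    {L : Submodule ℤ Γ} (h : ∃ y ∈ L, ∃ z ∈ L, ¬ (2 : ℤ) ∣ B y z) {ε : ℤ} (hε : Odd ε) :
    ∃ x ∈ L, 4 ∣ q x - ε := by
  obtain ⟨y, hy, z, hz, hyz⟩ := h
  have hodd : ∀ n : ℤ, Odd n → (n : ZMod 4) * n = 1 := fun n hn => by
    have h := Int.eight_dvd_sq_sub_one_of_odd hn
    have : (4 : ℤ) ∣ n * n - 1 := by rw [← sq]; exact Dvd.dvd.trans (by norm_num) h
    have := (ZMod.intCast_zmod_eq_zero_iff_dvd _ 4).2 this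
    push_cast at this
    exact sub_eq_zero.1 this
  obtain ⟨s, t, hst⟩ := binary_represents_odd_mod_four (q y) (B y z) (q z) ε
    (hodd _ (by rw [← Int.not_even_iff_odd, even_iff_two_dvd]; exact hyz)) (hodd _ hε)
  obtain ⟨s, rfl⟩ := ZMod.intCast_surjective s
  obtain ⟨t, rfl⟩ := ZMod.intCast_surjective t
  refine ⟨s • y + t • z, L.add_mem (L.smul_mem s hy) (L.smul_mem t hz), ?_⟩
  apply (ZMod.intCast_zmod_eq_zero_iff_dvd _ 4).1
  rw [q_combination hsymm hq]
  push_cast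
  rw [hst, sub_self]

theorem exists_q_mod_four_not_dvd (hsymm : ∀ x y, B x y = B y x) (hq : ∀ x, B x x = 2 * q x)
    {L : Submodule ℤ Γ} (h : ∀ l : ℕ, l.Prime → ∃ y ∈ L, ∃ z ∈ L, ¬ (l : ℤ) ∣ B y z) {ε : ℤ}
    (hε : Odd ε) (T : Finset ℕ) (hT : ∀ l ∈ T, l.Prime ∧ l ≠ 2) :
    ∃ x ∈ L, 4 ∣ q x - ε ∧ ∀ l ∈ T, ¬ (l : ℤ) ∣ q x := by
  induction T using Finset.induction_on with
  | empty => simpa using exists_q_mod_four hsymm hq (by simpa using h 2 Nat.prime_two) hε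
  | insert l T hlT ih =>
    obtain ⟨x, hx, hx4, hxT⟩ := ih fun l' hl' => hT l' (Finset.mem_insert_of_mem hl')
    obtain ⟨hl, hl2⟩ := hT l (Finset.mem_insert_self l T)
    obtain ⟨y, hy, hyl⟩ := exists_not_dvd_q hsymm hq (h l hl)
    have hcop : IsCoprime ((l : ℕ) : ℤ) ((4 * ∏ p ∈ T, p : ℕ) : ℤ) := by
      rw [Nat.isCoprime_iff_coprime]
      refine Nat.Coprime.mul_right ?_ (Nat.Coprime.prod_right fun p hp => ?_)
      · exact Nat.Coprime.pow_right 2 ((Nat.coprime_primes hl Nat.prime_two).2 hl2)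
      · exact (Nat.coprime_primes hl (hT p (Finset.mem_insert_of_mem hp)).1).2
          fun h => hlT (h ▸ hp)
    obtain ⟨r, s, hrs⟩ := hcop
    have hdiff1 : q ((r * l) • x + (1 - r * l) • y) - q x =
        (s * ((4 * ∏ p ∈ T, p : ℕ) : ℤ)) * (-(1 + r * l) * q x + r * l * B x y +
          (1 - r * l) * q y) := by
      rw [q_combination hsymm hq]
      have : s * ((4 * ∏ p ∈ T, p : ℕ) : ℤ) = 1 - r * l := by linarith
      rw [this]; ring
    have hdiff2 : q ((r * l) • x + (1 - r * l) • y) =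
        l * (r * (r * l * q x + (1 - r * l) * B x y + (r * l - 2) * q y)) + q y := by
      rw [q_combination hsymm hq]; ring
    refine ⟨(r * l) • x + (1 - r * l) • y, L.add_mem (L.smul_mem _ hx) (L.smul_mem _ hy), ?_, ?_⟩
    · have h4 : (4 : ℤ) ∣ q ((r * l) • x + (1 - r * l) • y) - q x := by
        rw [hdiff1]
        exact ((Dvd.intro _ (by push_cast; rfl) : (4 : ℤ) ∣ _).mul_left s).mul_right _
      simpa using dvd_add h4 hx4
    · intro p hp hdvd
      rcases Finset.mem_insert.1 hp with rfl | hp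
      · rw [hdiff2] at hdvd
        exact hyl ((dvd_add_right (dvd_mul_right _ _)).1 hdvd)
      · have hpd : (p : ℤ) ∣ q ((r * l) • x + (1 - r * l) • y) - q x := by
          rw [hdiff1]
          have : p ∣ 4 * ∏ p ∈ T, p := (Finset.dvd_prod_of_mem _ hp).mul_left 4
          exact ((Int.natCast_dvd_natCast.2 this).mul_left s).mul_right _
        exact hxT p hp ((dvd_sub_right hdvd).1 hpd)

/-- A sublattice that is not totally isotropic modulo any prime contains vectors of prescribed
sign whose half-norm is prime to a given odd number and has a given odd residue modulo `4`. -/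
theorem exists_q_coprime (hsymm : ∀ x y, B x y = B y x) (hq : ∀ x, B x x = 2 * q x)
    {L : Submodule ℤ Γ} (h : ∀ l : ℕ, l.Prime → ∃ y ∈ L, ∃ z ∈ L, ¬ (l : ℤ) ∣ B y z) {ε : ℤ}
    (hε : Odd ε) {m : ℕ} (hm : Odd m) {σ : ℤ} (hσ : |σ| = 1) (hL : ∃ y ∈ L, 0 < σ * q y) :
    ∃ x ∈ L, 4 ∣ q x - ε ∧ m.Coprime (q x).natAbs ∧ 0 < σ * q x := by
  obtain ⟨x, hx, hx4, hxm⟩ := exists_q_mod_four_not_dvd hsymm hq h hε m.primeFactors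
    fun l hl => ⟨Nat.prime_of_mem_primeFactors hl, fun h2 => by
      have := Nat.dvd_of_mem_primeFactors hl
      rw [h2] at this
      exact (Nat.not_even_iff_odd.2 hm) (even_iff_two_dvd.2 this)⟩
  obtain ⟨y, hy, hypos⟩ := hL
  set t : ℤ := |q x| + |B x y| + 1 with ht
  have hm0 : (0 : ℤ) < m := by exact_mod_cast hm.pos
  have hexp : q ((1 : ℤ) • x + (4 * m * t) • y) =
      q x + 4 * m * (t * B x y + 4 * m * t ^ 2 * q y) := by
    rw [q_combination hsymm hq]; ring
  refine ⟨(1 : ℤ) • x + (4 * m * t) • y, L.add_mem (L.smul_mem _ hx) (L.smul_mem _ hy),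
    ?_, ?_, ?_⟩
  · rw [hexp]
    have : q x + 4 * m * (t * B x y + 4 * m * t ^ 2 * q y) - ε =
      (q x - ε) + 4 * (m * (t * B x y + 4 * m * t ^ 2 * q y)) := by ring
    rw [this]
    exact dvd_add hx4 (dvd_mul_right _ _)
  · refine Nat.Coprime.symm (Nat.coprime_of_dvd fun p hp hpx hpm => ?_)
    refine hxm p (Nat.mem_primeFactors.2 ⟨hp, hpm, hm.pos.ne'⟩) ?_
    have hpx' := Int.natCast_dvd.2 hpx
    rw [hexp] at hpx'
    refine (dvd_add_left ?_).1 hpx'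
    exact ((Int.natCast_dvd_natCast.2 hpm).mul_left 4).mul_right _
  · have hbound : ∀ n : ℤ, -|n| ≤ σ * n := fun n => by
      have := neg_abs_le (σ * n)
      rwa [abs_mul, hσ, one_mul] at this
    rw [hexp]
    have h1 := hbound (q x)
    have h2 := hbound (B x y)
    have ht1 : 1 ≤ t := by have := abs_nonneg (q x); have := abs_nonneg (B x y); omega
    set M : ℤ := 4 * m * t with hM
    have hMt : t ≤ M := by nlinarith
    have h3 : M ≤ M * (σ * q y) := by nlinarith
    have h4 : |q x| + 1 ≤ σ * B x y + M * (σ * q y) := by linarith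
    have h5 : M * (|q x| + 1) ≤ M * (σ * B x y + M * (σ * q y)) :=
      mul_le_mul_of_nonneg_left h4 (by linarith)
    have h6 : |q x| + 1 ≤ M * (|q x| + 1) := by nlinarith [abs_nonneg (q x)]
    have : σ * (q x + 4 * m * (t * B x y + 4 * m * t ^ 2 * q y)) =
      σ * q x + M * (σ * B x y + M * (σ * q y)) := by rw [hM]; ring
    rw [this]
    linarith

end Lattice

section Isotropic

variable {Γ : Type*} [AddCommGroup Γ] {B : Γ →ₗ[ℤ] Γ →ₗ[ℤ] ℤ}

/-- The orthogonal complement of a pair of vectors in an even unimodular lattice with a positive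
definite real subspace of dimension `4` and a negative definite one of dimension `20` is
isotropic. -/
theorem exists_isotropic [Module.Free ℤ Γ] [Module.Finite ℤ Γ]
    (hsymm : ∀ x y, B x y = B y x) (heven : ∀ x, ∃ n : ℤ, B x x = 2 * n)
    (hunimod : Function.Bijective fun x : Γ => B x)
    {Bℝ : (ℝ ⊗[ℤ] Γ) →ₗ[ℝ] (ℝ ⊗[ℤ] Γ) →ₗ[ℝ] ℝ}
    (hBℝ : ∀ x y : Γ, Bℝ ((1 : ℝ) ⊗ₜ[ℤ] x) ((1 : ℝ) ⊗ₜ[ℤ] y) = (B x y : ℝ))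
    {P N : Submodule ℝ (ℝ ⊗[ℤ] Γ)}
    (hP4 : Module.finrank ℝ P = 4) (hP : ∀ z ∈ P, z ≠ 0 → 0 < Bℝ z z)
    (hN20 : Module.finrank ℝ N = 20) (hN : ∀ z ∈ N, z ≠ 0 → Bℝ z z < 0) (u v : Γ) :
    ∃ e : Γ, e ≠ 0 ∧ B e e = 0 ∧ B u e = 0 ∧ B v e = 0 := by
  choose q hq using heven
  have hrank : 20 ≤ Module.finrank ℤ Γ := by
    have := Submodule.finrank_le N
    rwa [hN20, Module.finrank_baseChange] at this
  have hpos : ∀ {k : ℕ} (S : Fin k → Γ), k < 4 → ∃ y ∈ orthLattice B S, 0 < 1 * q y := by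
    intro k S hk
    obtain ⟨y, hy, h⟩ := exists_pos_of_finrank hBℝ hP (L := orthLattice B S) (by
      have := finrank_le_finrank_orthLattice_add (B := B) S; omega)
    exact ⟨y, hy, by rw [hq] at h; omega⟩
  have hneg : ∀ {k : ℕ} (S : Fin k → Γ), k < 20 → ∃ y ∈ orthLattice B S, 0 < -1 * q y := by
    intro k S hk
    obtain ⟨y, hy, h⟩ := exists_pos_of_finrank (B := -B) (Bℝ := -Bℝ) (by simpa using hBℝ)
      (P := N) (by simpa using hN) (L := orthLattice B S) (by
      have := finrank_le_finrank_orthLattice_add (B := B) S; omega)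
    exact ⟨y, hy, by simp only [LinearMap.neg_apply, hq] at h; omega⟩
  have hloc : ∀ {k : ℕ} (S : Fin k → Γ), k < 10 → ∀ l : ℕ, l.Prime →
      ∃ y ∈ orthLattice B S, ∃ z ∈ orthLattice B S, ¬ (l : ℤ) ∣ B y z :=
    fun S hk l hl => exists_not_dvd_of_orthLattice hunimod S (by omega) hl
  have hodd : ∀ {n ε : ℤ}, Odd ε → 4 ∣ n - ε → Odd n.natAbs := fun hε h => by
    rw [Int.natAbs_odd]
    rw [Int.odd_iff] at hε ⊢
    omega
  obtain ⟨x₁, h₁, h₁4, -, h₁p⟩ := exists_q_coprime hsymm hq (hloc ![u, v] (by norm_num))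
    (ε := 1) odd_one (m := 1) odd_one (σ := 1) (by norm_num) (hpos _ (by norm_num))
  have o₁ := hodd odd_one h₁4
  obtain ⟨x₂, h₂, h₂4, h₂c, h₂p⟩ := exists_q_coprime hsymm hq (hloc ![u, v, x₁] (by norm_num))
    (ε := 1) odd_one o₁ (σ := 1) (by norm_num) (hpos _ (by norm_num))
  have o₂ := hodd odd_one h₂4
  obtain ⟨x₃, h₃, h₃4, h₃c, h₃p⟩ := exists_q_coprime hsymm hq
    (hloc ![u, v, x₁, x₂] (by norm_num)) (ε := -1) (by decide) (o₁.mul o₂) (σ := -1)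
    (by norm_num) (hneg _ (by norm_num))
  have o₃ := hodd (by decide) h₃4
  obtain ⟨x₄, h₄, h₄4, h₄c, h₄p⟩ := exists_q_coprime hsymm hq
    (hloc ![u, v, x₁, x₂, x₃] (by norm_num)) (ε := -1) (by decide) ((o₁.mul o₂).mul o₃) (σ := -1)
    (by norm_num) (hneg _ (by norm_num))
  simp only [mem_orthLattice, Fin.forall_fin_succ, Matrix.cons_val_zero, Matrix.cons_val_succ,
    IsEmpty.forall_iff, and_true] at h₁ h₂ h₃ h₄
  obtain ⟨hu1, hv1⟩ := h₁
  obtain ⟨hu2, hv2, h12⟩ := h₂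
  obtain ⟨hu3, hv3, h13, h23⟩ := h₃
  obtain ⟨hu4, hv4, h14, h24, h34⟩ := h₄
  obtain ⟨c13, c23⟩ := Nat.coprime_mul_iff_left.1 h₃c
  obtain ⟨c124, c34⟩ := Nat.coprime_mul_iff_left.1 h₄c
  obtain ⟨c14, c24⟩ := Nat.coprime_mul_iff_left.1 c124
  obtain ⟨x, y, z, w, hne, hzero⟩ := exists_quaternary_zero c13 h₂c c14 c23.symm c34 c24
    (by omega) o₃ o₂ (by omega)
  have e1 : ((q x₁).natAbs : ℤ) = q x₁ := by omega
  have e2 : ((q x₂).natAbs : ℤ) = q x₂ := by omega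
  have e3 : ((q x₃).natAbs : ℤ) = -q x₃ := by omega
  have e4 : ((q x₄).natAbs : ℤ) = -q x₄ := by omega
  rw [e1, e2, e3, e4] at hzero
  have h21 : B x₂ x₁ = 0 := by rw [hsymm, h12]
  have h31 : B x₃ x₁ = 0 := by rw [hsymm, h13]
  have h41 : B x₄ x₁ = 0 := by rw [hsymm, h14]
  have h32 : B x₃ x₂ = 0 := by rw [hsymm, h23]
  have h42 : B x₄ x₂ = 0 := by rw [hsymm, h24]
  have h43 : B x₄ x₃ = 0 := by rw [hsymm, h34]
  refine ⟨x • x₁ + y • x₃ + z • x₂ + w • x₄, fun h0 => ?_, ?_, ?_, ?_⟩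
  · have k1 := congrArg (B x₁) h0
    have k2 := congrArg (B x₂) h0
    have k3 := congrArg (B x₃) h0
    have k4 := congrArg (B x₄) h0
    simp only [map_add, map_smul, smul_eq_mul, map_zero, h12, h13, h14, h21, h23, h24,
      h31, h32, h34, h41, h42, h43, hq, mul_zero, add_zero, zero_add, mul_eq_zero] at k1 k2 k3 k4
    omega
  · simp only [map_add, map_smul, LinearMap.add_apply, LinearMap.smul_apply, smul_eq_mul, h12, h13,
      h14, h21, h23, h24, h31, h32, h34, h41, h42, h43, hq]
    linear_combination 2 * hzero
  · simp [hu1, hu2, hu3, hu4]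
  · simp [hv1, hv2, hv3, hv4]

/-- In a unimodular lattice every nonzero vector is a nonzero multiple of a vector `e` with
`⟨e, Γ⟩ = ℤ`. -/
theorem exists_primitive (hunimod : Function.Bijective fun x : Γ => B x) {x : Γ} (hx : x ≠ 0) :
    ∃ (g : ℤ) (e f : Γ), g ≠ 0 ∧ x = g • e ∧ B e f = 1 := by
  obtain ⟨g, hg⟩ := (IsPrincipalIdealRing.principal (LinearMap.range (B x))).principal
  have hBx : B x ≠ 0 := fun h => hx (hunimod.1 (by simpa using h))
  have hdvd : ∀ y, g ∣ B x y := fun y => by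
    have : B x y ∈ LinearMap.range (B x) := ⟨y, rfl⟩
    rw [hg] at this
    exact Ideal.mem_span_singleton.1 this
  have hg0 : g ≠ 0 := fun h => hBx (LinearMap.ext fun y => by
    simpa [h] using hdvd y)
  obtain ⟨f, hf⟩ : g ∈ LinearMap.range (B x) := by
    rw [hg]; exact Submodule.mem_span_singleton_self g
  let h : Γ →ₗ[ℤ] ℤ := AddMonoidHom.toIntLinearMap
    { toFun := fun y => B x y / g
      map_zero' := by simp
      map_add' := fun y z => by rw [map_add, Int.add_ediv_of_dvd_left (hdvd y)] }
  have hh : ∀ y, g * h y = B x y := fun y => Int.mul_ediv_cancel' (hdvd y)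
  obtain ⟨e, he⟩ := hunimod.2 h
  refine ⟨g, e, f, hg0, hunimod.1 (LinearMap.ext fun y => ?_), ?_⟩
  · simp only at he
    simp [he, hh]
  · simp only at he
    apply mul_left_cancel₀ hg0
    rw [he, hh, hf, mul_one]

/-- If the orthogonal complement of one hyperbolic pair `(u, v)` in an even unimodular lattice is
isotropic, the isometry group acts transitively on hyperbolic pairs. -/
theorem exists_isometry_of_isotropic (hsymm : ∀ x y, B x y = B y x)
    (heven : ∀ x, ∃ n : ℤ, B x x = 2 * n) (hunimod : Function.Bijective fun x : Γ => B x)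
    {u v u' v' e₀ : Γ}
    (huu : B u u = 0) (hvv : B v v = 0) (hu'u' : B u' u' = 0) (hv'v' : B v' v' = 0)
    (huv : B u v = 1) (hu'v' : B u' v' = 1)
    (he₀ : e₀ ≠ 0) (he₀e₀ : B e₀ e₀ = 0) (hue₀ : B u e₀ = 0) (hve₀ : B v e₀ = 0) :
    ∃ φ : Γ ≃ₗ[ℤ] Γ, (∀ x y, B (φ x) (φ y) = B x y) ∧ φ u = u' ∧ φ v = v' := by
  have hvu : B v u = 1 := by rw [hsymm, huv]
  obtain ⟨g, e, f₀, hg, rfl, hef₀⟩ := exists_primitive hunimod he₀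
  have hee : B e e = 0 := by simpa [hg] using he₀e₀
  have hue : B u e = 0 := by simpa [hg] using hue₀
  have hve : B v e = 0 := by simpa [hg] using hve₀
  have heu : B e u = 0 := by rw [hsymm, hue]
  have hev : B e v = 0 := by rw [hsymm, hve]
  obtain ⟨f₁, hf₁⟩ : ∃ f₁, f₁ = f₀ - B v f₀ • u - B u f₀ • v := ⟨_, rfl⟩
  have huf₁ : B u f₁ = 0 := by simp [hf₁, huu, huv]
  have hvf₁ : B v f₁ = 0 := by simp [hf₁, hvu, hvv]
  have hef₁ : B e f₁ = 1 := by simp [hf₁, heu, hev, hef₀]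
  have hf₁e : B f₁ e = 1 := by rw [hsymm, hef₁]
  obtain ⟨n, hn⟩ := heven f₁
  have key : ∀ x x', B x x = 0 → B x x' = 1 → SameOrbit B x e := fun x x' hx hxx' =>
    sameOrbit_of_two_hyperbolic_planes hsymm heven (f := f₁ - n • e) huu hvv huv hee
      (by simp [hn, hef₁, hf₁e, hee]; ring) (by simp [hef₁, hee]) hue (by simp [huf₁, hue]) hve
      (by simp [hvf₁, hve]) hx hxx'
  obtain ⟨ψ, hψ, hψu⟩ := (key u v huu huv).trans (key u' v' hu'u' hu'v').symm
  have hu'w : B u' (v' - ψ v) = 0 := by rw [map_sub, hu'v', ← hψu, hψ, huv, sub_self]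
  have hψv : B (ψ v) u' = 1 := by rw [← hψu, hψ, hvu]
  have hq : B (v' - ψ v) (v' - ψ v) = 2 * -B (ψ v) v' := by
    simp [hv'v', hψ, hvv, hsymm v' (ψ v)]; ring
  obtain ⟨τ, hτ, hτf⟩ := exists_transvection hsymm hu'u' hu'w hq
  refine ⟨ψ.trans τ, fun x y => by simp [hτ, hψ], ?_, ?_⟩
  · rw [LinearEquiv.trans_apply, hψu, hτf, hu'w, hu'u']; simp
  · rw [LinearEquiv.trans_apply, hτf, hψv, map_sub, hψ, hvv]; simp

end Isotropic

/-- The group of automorphisms of the even unimodular lattice `Γ^{4,20}` acts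
transitively on hyperbolic pairs of null vectors. -/
theorem stmt6 (Γ : Type*) [AddCommGroup Γ] [Module ℤ Γ]
    [Module.Free ℤ Γ] [Module.Finite ℤ Γ]
    (B : Γ →ₗ[ℤ] Γ →ₗ[ℤ] ℤ)
    (hsymm : ∀ x y, B x y = B y x)
    (heven : ∀ x, ∃ n : ℤ, B x x = 2 * n)
    (hunimod : Function.Bijective fun x : Γ => B x)
    -- the extension of `B` to `Γ ⊗ ℝ` …
    (Bℝ : (ℝ ⊗[ℤ] Γ) →ₗ[ℝ] (ℝ ⊗[ℤ] Γ) →ₗ[ℝ] ℝ)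
    (hBℝ : ∀ x y : Γ, Bℝ ((1 : ℝ) ⊗ₜ[ℤ] x) ((1 : ℝ) ⊗ₜ[ℤ] y) = (B x y : ℝ))
    -- … has signature (4,20)
    (hsig : ∃ P N : Submodule ℝ (ℝ ⊗[ℤ] Γ),
        Module.finrank ℝ P = 4 ∧ (∀ z ∈ P, z ≠ 0 → 0 < Bℝ z z) ∧
        Module.finrank ℝ N = 20 ∧ (∀ z ∈ N, z ≠ 0 → Bℝ z z < 0))
    (u v u' v' : Γ)
    (huu : B u u = 0) (hvv : B v v = 0) (hu'u' : B u' u' = 0) (hv'v' : B v' v' = 0)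
    (huv : B u v = 1) (hu'v' : B u' v' = 1) :
    ∃ φ : Γ ≃ₗ[ℤ] Γ, (∀ x y, B (φ x) (φ y) = B x y) ∧ φ u = u' ∧ φ v = v' := by
  obtain rfl : ‹Module ℤ Γ› = AddCommGroup.toIntModule Γ := Subsingleton.elim _ _
  obtain ⟨P, N, hP4, hP, hN20, hN⟩ := hsig
  obtain ⟨e, he, hee, hue, hve⟩ :=
    exists_isotropic hsymm heven hunimod hBℝ hP4 hP hN20 hN u v
  exact exists_isometry_of_isotropic hsymm heven hunimod huu hvv hu'u' hv'v' huv hu'v' he hee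
    hue hve
end

section
/- Let H be the subgroup of (ℤ/4ℤ)^4 generated by the three elements (2,2,0,0), (2,0,2,0) and (1,1,1,1). Then H equals its own annihilator with respect to the standard pairing: H = {b ∈ (ℤ/4ℤ)^4 : a₁b₁ + a₂b₂ + a₃b₃ + a₄b₄ = 0 in ℤ/4ℤ for all a ∈ H}. -/
/-- The subgroup of `(ℤ/4ℤ)^4` generated by `(2,2,0,0)`, `(2,0,2,0)` and `(1,1,1,1)`. -/
def H7 : AddSubgroup (Fin 4 → ZMod 4) :=
  AddSubgroup.closure {![2, 2, 0, 0], ![2, 0, 2, 0], ![1, 1, 1, 1]}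

set_option synthInstance.maxSize 1000 in
theorem exists_eq_combination_of_orthogonal_generators :
    ∀ x y z w : ZMod 4, 2 * x + 2 * y = 0 → 2 * x + 2 * z = 0 → x + y + z + w = 0 →
      ∃ m n : Fin 2, x = m.val • 2 + n.val • 2 + w ∧ y = m.val • 2 + w ∧ z = n.val • 2 + w := by
  decide

theorem sum_mul_eq_zero_of_mem_H7 {a b : Fin 4 → ZMod 4} (ha : a ∈ H7) (hb : b ∈ H7) :
    ∑ i, a i * b i = 0 := by
  induction ha, hb using AddSubgroup.closure_induction₂ with
  | mem x y hx hy =>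
    rcases hx with rfl | rfl | rfl <;> rcases hy with rfl | rfl | rfl <;> decide
  | zero_left => simp
  | zero_right => simp
  | add_left x y z _ _ _ hx hy => simp [add_mul, Finset.sum_add_distrib, hx, hy]
  | add_right x y z _ _ _ hx hy => simp [mul_add, Finset.sum_add_distrib, hx, hy]
  | neg_left x y _ _ h => simp [h]
  | neg_right x y _ _ h => simp [h]

/-- The Greene/Plesser group of the Gepner type model `(2̃)^4`: the subgroup `H` of
`(ℤ/4ℤ)^4` generated by `(2,2,0,0)`, `(2,0,2,0)` and `(1,1,1,1)` equals its own
annihilator with respect to the standard pairing. -/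
theorem stmt7 :
    (H7 : Set (Fin 4 → ZMod 4)) = {b | ∀ a ∈ H7, ∑ i, a i * b i = 0} := by
  refine Set.Subset.antisymm (fun b hb a ha => sum_mul_eq_zero_of_mem_H7 ha hb) fun b hb => ?_
  have hv₁ : ![2, 2, 0, 0] ∈ H7 := AddSubgroup.subset_closure (by simp)
  have hv₂ : ![2, 0, 2, 0] ∈ H7 := AddSubgroup.subset_closure (by simp)
  have hv₃ : ![1, 1, 1, 1] ∈ H7 := AddSubgroup.subset_closure (by simp)
  obtain ⟨m, n, h₀, h₁, h₂⟩ :=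
    exists_eq_combination_of_orthogonal_generators (b 0) (b 1) (b 2) (b 3)
    (by simpa [Fin.sum_univ_four] using hb _ hv₁)
    (by simpa [Fin.sum_univ_four] using hb _ hv₂)
    (by simpa [Fin.sum_univ_four] using hb _ hv₃)
  have hb_eq : b = m.val • ![2, 2, 0, 0] + n.val • ![2, 0, 2, 0] + (b 3).val • ![1, 1, 1, 1] := by
    ext i
    fin_cases i
    · simpa using h₀
    · simpa using h₁
    · simpa using h₂
    · simp
  rw [hb_eq]
  exact add_mem (add_mem (nsmul_mem hv₁ _) (nsmul_mem hv₂ _)) (nsmul_mem hv₃ _)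
end
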